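/- arXiv:2004.11290 — 2 statements merged into one kernel-verified Lean document; each statement's English description precedes it below -/
import Mathlib

section
/- For s > 0 small enough that g₀(s) < 1, let γ_s denote the unique admissible function attaining the infimum defining g₀(s), and let η̄ be the unique minimizer of H over A_H. Then the rescaled minimizers s^{−4/3}·γ_s converge uniformly on [0,1] to η̄ as s → 0⁺. -/
open MeasureTheory Set Filter

/-- Hypotheses on the function `f₁` from Section 6.1 of the paper. -/
structure F1Hyp (ℓ ℓ₁ : ℝ) (f₁ : ℝ → ℝ) : Prop where
  hl : 0 < ℓ
  hl1 : 0 < ℓ₁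
  cont : ContinuousOn f₁ (Icc 0 1)
  diff : ∃ d : ℝ → ℝ, ContinuousOn d (Ioc 0 1) ∧
    ∀ t ∈ Ioc (0:ℝ) 1, HasDerivWithinAt f₁ (d t) (Ioc 0 1) t
  anti : StrictAntiOn f₁ (Icc 0 1)
  nonneg : ∀ t ∈ Icc (0:ℝ) 1, 0 ≤ f₁ t
  f10 : f₁ 0 = ℓ
  f11 : f₁ 1 = 0
  convexSqrt : ConvexOn ℝ (Icc 0 1) (fun u => f₁ (Real.sqrt u))
  lim0 : Tendsto (fun s => (f₁ s - ℓ + ℓ₁ * s) / s) (nhdsWithin 0 (Ioi 0)) (nhds 0)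

/-- `γ` is admissible, with a.e. derivative `γ'` (absolute continuity is encoded by the
fundamental theorem of calculus representation with an `L¹` derivative). -/
def Admissible (γ γ' : ℝ → ℝ) : Prop :=
  IntegrableOn γ' (Icc 0 1) ∧
  (∀ t ∈ Icc (0:ℝ) 1, γ t = ∫ u in (0:ℝ)..t, γ' u) ∧
  (∀ t ∈ Icc (0:ℝ) 1, 0 ≤ γ t ∧ γ t ≤ 1) ∧
  γ 0 = 0 ∧ γ 1 = 0

/-- The energy in the characterization (6.11). -/
noncomputable def energy (f₁ : ℝ → ℝ) (s : ℝ) (γ γ' : ℝ → ℝ) : ℝ :=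
  ∫ t in (0:ℝ)..1, Real.sqrt (s ^ 2 * (f₁ (Real.sqrt (γ t))) ^ 2 + (γ' t) ^ 2 / 4)

/-- The cohesive energy density of pristine material, via characterization (6.11). -/
noncomputable def g0 (f₁ : ℝ → ℝ) (s : ℝ) : ℝ :=
  sInf {x | ∃ γ γ' : ℝ → ℝ, Admissible γ γ' ∧ x = energy f₁ s γ γ'}


/-- `η` belongs to the class `A_H`, with derivative `η' ∈ L²(0,1)`. -/
def AdmissibleH (η η' : ℝ → ℝ) : Prop :=
  IntegrableOn η' (Icc 0 1) ∧
  IntegrableOn (fun t => (η' t) ^ 2) (Icc 0 1) ∧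
  (∀ t ∈ Icc (0:ℝ) 1, η t = ∫ u in (0:ℝ)..t, η' u) ∧
  (∀ t ∈ Icc (0:ℝ) 1, 0 ≤ η t) ∧
  η 0 = 0 ∧ η 1 = 0

/-- The limit functional `H` of (8.12). -/
noncomputable def Hfun (ℓ ℓ₁ : ℝ) (η η' : ℝ → ℝ) : ℝ :=
  ∫ t in (0:ℝ)..1, (-(ℓ₁ / ℓ) * Real.sqrt (η t) + (η' t) ^ 2 / (8 * ℓ ^ 2))

/-- The infimum of `H` over the class `A_H`. -/
noncomputable def minH (ℓ ℓ₁ : ℝ) : ℝ :=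
  sInf {x | ∃ η η' : ℝ → ℝ, AdmissibleH η η' ∧ x = Hfun ℓ ℓ₁ η η'}


/-- Integration by parts for primitives of integrable functions. -/
lemma ibp01 (f g F G : ℝ → ℝ) (hf : IntervalIntegrable f volume 0 1)
    (hg : IntervalIntegrable g volume 0 1)
    (hF : ∀ t ∈ Icc (0:ℝ) 1, F t = F 0 + ∫ u in (0:ℝ)..t, f u)
    (hG : ∀ t ∈ Icc (0:ℝ) 1, G t = G 0 + ∫ u in (0:ℝ)..t, g u) :
    ∫ t in (0:ℝ)..1, F t * g t = F 1 * G 1 - F 0 * G 0 - ∫ t in (0:ℝ)..1, f t * G t := by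
  have key : ∀ (f F : ℝ → ℝ), IntervalIntegrable f volume 0 1 →
      AbsolutelyContinuousOnInterval (fun t => F 0 + ∫ u in (0:ℝ)..t, f u) 0 1 ∧
      ∀ᵐ x, x ∈ uIcc (0:ℝ) 1 → deriv (fun t => F 0 + ∫ u in (0:ℝ)..t, f u) x = f x := by
    intro f F hf
    constructor
    · have h1 := hf.absolutelyContinuousOnInterval_intervalIntegral (c := 0) (by simp)
      have h2 : AbsolutelyContinuousOnInterval (fun _ : ℝ => F 0) 0 1 :=
        (LipschitzOnWith.absolutelyContinuousOnInterval (K := 0)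
          ((LipschitzWith.const (F 0)).lipschitzOnWith))
      exact h2.add h1
    · filter_upwards [hf.ae_hasDerivAt_integral] with x hx hx1
      exact ((hx hx1 0 (by simp)).const_add (F 0)).deriv
  obtain ⟨aF, dF⟩ := key f F hf
  obtain ⟨aG, dG⟩ := key g G hg
  have := aF.integral_mul_deriv_eq_deriv_mul aG
  have e1 : ∫ t in (0:ℝ)..1, F t * g t = ∫ t in (0:ℝ)..1,
      (F 0 + ∫ u in (0:ℝ)..t, f u) * deriv (fun t => G 0 + ∫ u in (0:ℝ)..t, g u) t := by
    apply intervalIntegral.integral_congr_ae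
    filter_upwards [dG] with x hx hx1
    have h1 : x ∈ uIcc (0:ℝ) 1 := uIoc_subset_uIcc hx1
    rw [hx h1, hF x (by simpa using h1)]
  have e2 : ∫ t in (0:ℝ)..1, f t * G t = ∫ t in (0:ℝ)..1,
      deriv (fun t => F 0 + ∫ u in (0:ℝ)..t, f u) t * (G 0 + ∫ u in (0:ℝ)..t, g u) := by
    apply intervalIntegral.integral_congr_ae
    filter_upwards [dF] with x hx hx1
    have h1 : x ∈ uIcc (0:ℝ) 1 := uIoc_subset_uIcc hx1
    rw [hx h1, hG x (by simpa using h1)]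
  rw [e1, e2, this, hF 1 (by simp), hG 1 (by simp)]
  simp

/-- The explicit solution of `3 z - z ^ 3 = 4 t - 2`. -/
noncomputable def zf (t : ℝ) : ℝ := 2 * Real.sin (Real.arcsin (2 * t - 1) / 3)

lemma zf_cont : Continuous zf := by
  unfold zf
  have := Real.continuous_arcsin
  fun_prop

lemma zf_zero : zf 0 = -1 := by
  have : (-(Real.pi / 2) / 3) = -(Real.pi / 6) := by ring
  simp only [zf]
  norm_num
  rw [this, Real.sin_neg, Real.sin_pi_div_six]; norm_num

lemma zf_one : zf 1 = 1 := by
  have : ((Real.pi / 2) / 3) = (Real.pi / 6) := by ring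
  simp only [zf]
  norm_num
  rw [this, Real.sin_pi_div_six]; norm_num

lemma zf_sq_le (t : ℝ) : zf t ^ 2 ≤ 1 := by
  have h1 := Real.neg_pi_div_two_le_arcsin (2 * t - 1)
  have h2 := Real.arcsin_le_pi_div_two (2 * t - 1)
  have hp := Real.pi_pos
  have a1 : Real.sin (Real.arcsin (2 * t - 1) / 3) ≤ Real.sin (Real.pi / 6) := by
    apply Real.sin_le_sin_of_le_of_le_pi_div_two <;> linarith
  have a2 : Real.sin (-(Real.pi / 6)) ≤ Real.sin (Real.arcsin (2 * t - 1) / 3) := by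
    apply Real.sin_le_sin_of_le_of_le_pi_div_two <;> linarith
  rw [Real.sin_neg] at a2
  rw [Real.sin_pi_div_six] at a1 a2
  unfold zf
  nlinarith

lemma zf_sq_lt {t : ℝ} (h0 : 0 < t) (h1 : t < 1) : zf t ^ 2 < 1 := by
  have h1 := Real.neg_pi_div_two_lt_arcsin.2 (show -1 < 2 * t - 1 by linarith)
  have h2 := Real.arcsin_lt_pi_div_two.2 (show 2 * t - 1 < 1 by linarith)
  have hp := Real.pi_pos
  have a1 : Real.sin (Real.arcsin (2 * t - 1) / 3) < Real.sin (Real.pi / 6) := by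
    apply Real.sin_lt_sin_of_lt_of_le_pi_div_two <;> linarith
  have a2 : Real.sin (-(Real.pi / 6)) < Real.sin (Real.arcsin (2 * t - 1) / 3) := by
    apply Real.sin_lt_sin_of_lt_of_le_pi_div_two <;> linarith
  rw [Real.sin_neg] at a2
  rw [Real.sin_pi_div_six] at a1 a2
  unfold zf
  nlinarith

lemma zf_deriv {t : ℝ} (h0 : 0 < t) (h1 : t < 1) :
    HasDerivAt zf (4 / (3 * (1 - zf t ^ 2))) t := by
  have hlt := zf_sq_lt h0 h1
  have d1 : HasDerivAt (fun t : ℝ => 2 * t - 1) 2 t := by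
    simpa using ((hasDerivAt_id t).const_mul 2).sub_const 1
  have d2 := (Real.hasDerivAt_arcsin (x := 2 * t - 1) (by linarith) (by linarith)).comp t d1
  have d3 := ((d2.div_const 3).sin).const_mul 2
  refine d3.congr_deriv ?_
  set α := Real.arcsin (2 * t - 1) / 3 with hα
  have hz : zf t = 2 * Real.sin α := rfl
  have hs : Real.sqrt (1 - (2 * t - 1) ^ 2) = 4 * Real.cos α ^ 3 - 3 * Real.cos α := by
    rw [← Real.cos_arcsin, ← Real.cos_three_mul]; congr 1; rw [hα]; ring
  have hsp : 0 < Real.sqrt (1 - (2 * t - 1) ^ 2) := by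
    apply Real.sqrt_pos.2; nlinarith
  simp only [Function.comp_apply]
  rw [← hα] 
  rw [hz] at hlt ⊢
  rw [hs] at hsp ⊢
  have hc : Real.cos α ≠ 0 := by
    intro h; rw [h] at hsp; norm_num at hsp
  have h4 := Real.sin_sq_add_cos_sq α
  have e : 1 - (2 * Real.sin α) ^ 2 = 4 * Real.cos α ^ 2 - 3 := by nlinarith
  have e' : 4 * Real.cos α ^ 2 - 3 ≠ 0 := by rw [← e]; linarith
  rw [e]
  have e2 : 4 * Real.cos α ^ 3 - 3 * Real.cos α = Real.cos α * (4 * Real.cos α ^ 2 - 3) := by ring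
  rw [e2]
  field_simp
  norm_num

lemma zd_int : IntervalIntegrable (fun t => 4 / (3 * (1 - zf t ^ 2))) volume 0 1 := by
  apply intervalIntegral.intervalIntegrable_deriv_of_nonneg (g := zf) zf_cont.continuousOn
  · intro x hx
    simp at hx
    exact zf_deriv hx.1 hx.2
  · intro x hx
    simp at hx
    have := zf_sq_lt hx.1 hx.2
    apply div_nonneg <;> linarith

lemma zf_prim (t : ℝ) (ht : t ∈ Icc (0:ℝ) 1) :
    zf t = zf 0 + ∫ u in (0:ℝ)..t, 4 / (3 * (1 - zf u ^ 2)) := by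
  rw [intervalIntegral.integral_eq_sub_of_hasDerivAt_of_le ht.1 zf_cont.continuousOn]
  · ring
  · intro x hx
    exact zf_deriv hx.1 (hx.2.trans_le ht.2)
  · apply zd_int.mono_set
    rw [uIcc_of_le ht.1, uIcc_of_le zero_le_one]
    exact Icc_subset_Icc_right ht.2

/-- explicit minimizer and its derivative -/
noncomputable def etaE (R t : ℝ) : ℝ := (R * (1 - zf t ^ 2)) ^ 2
noncomputable def qE (R t : ℝ) : ℝ := -(16 / 3) * R ^ 2 * zf t

lemma qE_cont (R : ℝ) : Continuous (qE R) := by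
  unfold qE; have := zf_cont; fun_prop

lemma etaE_cont (R : ℝ) : Continuous (etaE R) := by
  unfold etaE; have := zf_cont; fun_prop

lemma etaE_zero (R : ℝ) : etaE R 0 = 0 := by simp [etaE, zf_zero]
lemma etaE_one (R : ℝ) : etaE R 1 = 0 := by simp [etaE, zf_one]

lemma etaE_sqrt {R : ℝ} (hR : 0 < R) (t : ℝ) : Real.sqrt (etaE R t) = R * (1 - zf t ^ 2) := by
  unfold etaE
  exact Real.sqrt_sq (mul_nonneg hR.le (by linarith [zf_sq_le t]))

lemma qE_le (R t : ℝ) : |qE R t| ≤ 16 / 3 * R ^ 2 := by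
  have h := zf_sq_le t
  have : |zf t| ≤ 1 := by
    rw [← sq_le_one_iff_abs_le_one]; exact h
  unfold qE
  rw [abs_mul, abs_mul, abs_of_nonneg (sq_nonneg R), abs_of_neg (by norm_num)]
  nlinarith [sq_nonneg R, mul_le_mul_of_nonneg_left this (sq_nonneg R)]

lemma etaE_prim (R t : ℝ) (ht : t ∈ Icc (0:ℝ) 1) :
    etaE R t = ∫ u in (0:ℝ)..t, qE R u := by
  rw [intervalIntegral.integral_eq_sub_of_hasDerivAt_of_le ht.1 (f := etaE R)
    (etaE_cont R).continuousOn]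
  · rw [etaE_zero]; ring
  · intro x hx
    have h1 : x < 1 := hx.2.trans_le ht.2
    have hlt := zf_sq_lt hx.1 h1
    have := ((((zf_deriv hx.1 h1).pow 2).const_sub 1).const_mul R).pow 2
    refine this.congr_deriv ?_
    have e : 1 - zf x ^ 2 ≠ 0 := by linarith
    simp only [qE]
    simp
    field_simp
    ring
  · exact (qE_cont R).intervalIntegrable _ _

/-- First-order optimality of the explicit function. -/
lemma EL {R ℓ ℓ₁ : ℝ} (hR : 0 < R) (hR3 : R ^ 3 = 9 * (ℓ * ℓ₁) / 32) (η η' : ℝ → ℝ)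
    (hi : IntervalIntegrable η' volume 0 1)
    (hp : ∀ t ∈ Icc (0:ℝ) 1, η t = ∫ u in (0:ℝ)..t, η' u)
    (h0 : ∀ t ∈ Icc (0:ℝ) 1, 0 ≤ η t) (h1 : η 1 = 0) :
    4 * (ℓ * ℓ₁) * ∫ t in (0:ℝ)..1, (Real.sqrt (η t) - Real.sqrt (etaE R t)) ≤
      ∫ t in (0:ℝ)..1, qE R t * (η' t - qE R t) := by
  have e0 : η 0 = 0 := by simpa using hp 0 (by simp)
  have qi : IntervalIntegrable (qE R) volume 0 1 := (qE_cont R).intervalIntegrable _ _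
  have hηc : ContinuousOn η (uIcc 0 1) := by
    have := (hi.absolutelyContinuousOnInterval_intervalIntegral (c := 0) (by simp)).continuousOn
    refine this.congr ?_
    intro t ht
    exact hp t (by simpa using ht)
  have hh : ∀ t ∈ Icc (0:ℝ) 1, (fun t => η t - etaE R t) t = (fun t => η t - etaE R t) 0 +
      ∫ u in (0:ℝ)..t, (η' u - qE R u) := by
    intro t ht
    have hs : uIcc 0 t ⊆ uIcc (0:ℝ) 1 := by
      rw [uIcc_of_le ht.1, uIcc_of_le zero_le_one]
      exact Icc_subset_Icc_right ht.2
    rw [intervalIntegral.integral_sub (hi.mono_set hs) (qi.mono_set hs)]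
    simp only [e0, etaE_zero, hp t ht, etaE_prim R t ht]; ring
  have := ibp01 _ (fun t => η' t - qE R t) zf (fun t => η t - etaE R t) zd_int (hi.sub qi)
    zf_prim hh
  simp only [h1, e0, etaE_zero, etaE_one] at this
  have e : ∫ t in (0:ℝ)..1, qE R t * (η' t - qE R t) =
      ∫ t in (0:ℝ)..1, (16 / 3 * R ^ 2) * (4 / (3 * (1 - zf t ^ 2)) * (η t - etaE R t)) := by
    rw [intervalIntegral.integral_const_mul]
    have e2 : ∫ t in (0:ℝ)..1, qE R t * (η' t - qE R t) =
      ∫ t in (0:ℝ)..1, (-(16 / 3) * R ^ 2) * (zf t * (η' t - qE R t)) := by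
      congr 1; ext t; simp only [qE]; ring
    rw [e2, intervalIntegral.integral_const_mul, this]; ring
  rw [e, ← intervalIntegral.integral_const_mul]
  apply intervalIntegral.integral_mono_on_of_le_Ioo zero_le_one
  · apply ContinuousOn.intervalIntegrable
    apply ContinuousOn.const_mul
    exact (Real.continuous_sqrt.comp_continuousOn hηc).sub
      (Real.continuous_sqrt.comp (etaE_cont R)).continuousOn
  · exact (zd_int.mul_continuousOn (hηc.sub (etaE_cont R).continuousOn)).const_mul _
  · intro t ht
    have hlt := zf_sq_lt ht.1 ht.2
    have ha := Real.sq_sqrt (h0 t ⟨ht.1.le, ht.2.le⟩)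
    rw [etaE_sqrt hR]
    set a := Real.sqrt (η t)
    have hb : 0 < 1 - zf t ^ 2 := by linarith
    rw [← ha]
    unfold etaE
    set b := 1 - zf t ^ 2
    have e3 : ℓ * ℓ₁ = 32 / 9 * R ^ 3 := by linarith
    rw [e3]
    have : 16 / 3 * R ^ 2 * (4 / (3 * b) * (a ^ 2 - (R * b) ^ 2)) -
      4 * (32 / 9 * R ^ 3) * (a - R * b) = 64 / 9 * R ^ 2 / b * (a - R * b) ^ 2 := by
      field_simp
      ring
    have h2 : 0 ≤ 64 / 9 * R ^ 2 / b * (a - R * b) ^ 2 := by positivity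
    linarith

set_option maxHeartbeats 2000000 in
/-- Pointwise strong convexity lower bound. -/
lemma pt_lower {ℓ Q q σ f τ x : ℝ} (hl : 0 < ℓ) (hq : |q| ≤ Q) (hσ : 0 < σ) (hσ1 : σ ≤ 1)
    (hf0 : 0 ≤ f) (hfl : f ≤ ℓ) (hτ : 0 < τ) (hτ1 : τ ≤ 1) :
    f - ℓ + Real.sqrt (ℓ ^ 2 + σ ^ 2 * q ^ 2 / 4) + σ ^ 2 * (q * (x - q) / (4 * ℓ)
      - Q ^ 3 / ℓ ^ 3 * σ ^ 2 * |x - q|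
      + ℓ ^ 2 / (8 * (ℓ + Q + 1) ^ 3) * τ / 2 * (|x - q| - τ))
      ≤ Real.sqrt (f ^ 2 + σ ^ 2 * x ^ 2 / 4) := by
  have hQ : 0 ≤ Q := (abs_nonneg q).trans hq
  set A := Real.sqrt (ℓ ^ 2 + σ ^ 2 * x ^ 2 / 4) with hA
  set B := Real.sqrt (ℓ ^ 2 + σ ^ 2 * q ^ 2 / 4) with hB
  set D := Real.sqrt (f ^ 2 + σ ^ 2 * x ^ 2 / 4) with hD
  have A2 : A ^ 2 = ℓ ^ 2 + σ ^ 2 * x ^ 2 / 4 := Real.sq_sqrt (by positivity)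
  have B2 : B ^ 2 = ℓ ^ 2 + σ ^ 2 * q ^ 2 / 4 := Real.sq_sqrt (by positivity)
  have D2 : D ^ 2 = f ^ 2 + σ ^ 2 * x ^ 2 / 4 := Real.sq_sqrt (by positivity)
  have A0 : 0 ≤ A := Real.sqrt_nonneg _
  have B0 : 0 ≤ B := Real.sqrt_nonneg _
  have D0 : 0 ≤ D := Real.sqrt_nonneg _
  have Al : ℓ ≤ A := Real.le_sqrt_of_sq_le (by nlinarith [mul_nonneg (sq_nonneg σ) (sq_nonneg x)])
  have Bl : ℓ ≤ B := Real.le_sqrt_of_sq_le (by nlinarith [mul_nonneg (sq_nonneg σ) (sq_nonneg q)])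
  have Df : f ≤ D := Real.le_sqrt_of_sq_le (by nlinarith [mul_nonneg (sq_nonneg σ) (sq_nonneg x)])
  have hσ2 : σ ^ 2 ≤ 1 := by nlinarith
  -- step 1
  have s1 : f - ℓ + A ≤ D := by
    by_contra hcon
    push Not at hcon
    nlinarith
  -- bounds
  have hx : |x| ≤ |x - q| + Q := by
    have := abs_add_le (x - q) q
    rw [sub_add_cancel] at this; linarith
  set y := |x - q| with hy
  have y0 : 0 ≤ y := abs_nonneg _
  have y2 : y ^ 2 = (x - q) ^ 2 := sq_abs _
  have Au : A ≤ (ℓ + Q + 1) * (1 + y) := by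
    have : A ≤ ℓ + |x| := by
      apply Real.sqrt_le_iff.2
      refine ⟨by positivity, ?_⟩
      nlinarith [sq_abs x, abs_nonneg x, mul_le_mul_of_nonneg_right hσ2 (sq_nonneg x)]
    nlinarith
  have Bu : B ≤ ℓ + Q + 1 := by
    have : B ≤ ℓ + |q| := by
      apply Real.sqrt_le_iff.2
      refine ⟨by positivity, ?_⟩
      nlinarith [sq_abs q, abs_nonneg q, mul_le_mul_of_nonneg_right hσ2 (sq_nonneg q)]
    linarith
  have Apos : 0 < A := by linarith
  have Bpos : 0 < B := by linarith
  -- step 2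
  have hCS : ℓ ^ 2 + σ ^ 2 * q * x / 4 ≤ A * B := by
    apply le_of_abs_le
    apply abs_le_of_sq_le_sq _ (by positivity)
    have : (A * B) ^ 2 = A ^ 2 * B ^ 2 := by ring
    rw [this, A2, B2]
    nlinarith [mul_nonneg (mul_nonneg (sq_nonneg σ) (sq_nonneg ℓ)) (sq_nonneg (x - q))]
  have s2 : B + σ ^ 2 / 4 * (q / B) * (x - q) + σ ^ 2 * ℓ ^ 2 * y ^ 2 / (8 * A * B ^ 2) ≤ A := by
    have id1 : (A * B - (ℓ ^ 2 + σ ^ 2 * q * x / 4)) * (A * B + (ℓ ^ 2 + σ ^ 2 * q * x / 4))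
        = ℓ ^ 2 * σ ^ 2 * (x - q) ^ 2 / 4 := by
      have : (A * B - (ℓ ^ 2 + σ ^ 2 * q * x / 4)) * (A * B + (ℓ ^ 2 + σ ^ 2 * q * x / 4))
        = A ^ 2 * B ^ 2 - (ℓ ^ 2 + σ ^ 2 * q * x / 4) ^ 2 := by ring
      rw [this, A2, B2]; ring
    have h3 : ℓ ^ 2 * σ ^ 2 * (x - q) ^ 2 / 4 ≤
        (A * B - (ℓ ^ 2 + σ ^ 2 * q * x / 4)) * (2 * (A * B)) := by
      rw [← id1]
      apply mul_le_mul_of_nonneg_left <;> linarith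
    have h4 : A - (B + σ ^ 2 / 4 * (q / B) * (x - q) +
        σ ^ 2 * ℓ ^ 2 * y ^ 2 / (8 * A * B ^ 2)) =
        ((A * B - (ℓ ^ 2 + σ ^ 2 * q * x / 4)) * (2 * (A * B)) -
          ℓ ^ 2 * σ ^ 2 * (x - q) ^ 2 / 4) / (2 * A * B ^ 2) := by
      rw [y2]
      field_simp
      have : B ^ 2 = ℓ ^ 2 + σ ^ 2 * q ^ 2 / 4 := B2
      linear_combination (-64 * A * B) * B2
    have h5 : 0 ≤ ((A * B - (ℓ ^ 2 + σ ^ 2 * q * x / 4)) * (2 * (A * B)) -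
          ℓ ^ 2 * σ ^ 2 * (x - q) ^ 2 / 4) / (2 * A * B ^ 2) := by
      apply div_nonneg <;> [linarith; positivity]
    linarith
  -- step 3
  have s3 : q * (x - q) / (4 * ℓ) - Q ^ 3 / ℓ ^ 3 * σ ^ 2 * y ≤ 1 / 4 * (q / B) * (x - q) := by
    have e : q * (x - q) / (4 * ℓ) - 1 / 4 * (q / B) * (x - q)
        = (B - ℓ) / (4 * ℓ * B) * (q * (x - q)) := by
      field_simp
    have hBl : B - ℓ ≤ σ ^ 2 * Q ^ 2 / ℓ := by
      rw [le_div_iff₀ hl]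
      have q2 : q ^ 2 ≤ Q ^ 2 := by rw [← sq_abs q]; gcongr
      nlinarith [mul_le_mul_of_nonneg_left q2 (sq_nonneg σ), mul_nonneg (sq_nonneg σ) (sq_nonneg Q)]
    have h6 : q * (x - q) ≤ Q * y := by
      calc q * (x - q) ≤ |q * (x - q)| := le_abs_self _
        _ = |q| * y := abs_mul _ _
        _ ≤ Q * y := by gcongr
    have h7 : (B - ℓ) / (4 * ℓ * B) ≤ σ ^ 2 * Q ^ 2 / ℓ / (ℓ * ℓ) := by
      apply div_le_div₀ (by positivity) hBl (by positivity)
      nlinarith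
    have h8 : 0 ≤ (B - ℓ) / (4 * ℓ * B) := div_nonneg (by linarith) (by positivity)
    have : (B - ℓ) / (4 * ℓ * B) * (q * (x - q)) ≤ σ ^ 2 * Q ^ 2 / ℓ / (ℓ * ℓ) * (Q * y) := by
      calc _ ≤ (B - ℓ) / (4 * ℓ * B) * (Q * y) := by gcongr
        _ ≤ _ := by gcongr
    have e3 : σ ^ 2 * Q ^ 2 / ℓ / (ℓ * ℓ) * (Q * y) = Q ^ 3 / ℓ ^ 3 * σ ^ 2 * y := by
      field_simp
    linarith
  -- step 4
  have s4 : ℓ ^ 2 / (8 * (ℓ + Q + 1) ^ 3) * τ / 2 * (y - τ) ≤ ℓ ^ 2 * y ^ 2 / (8 * A * B ^ 2) := by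
    have h9 : 8 * A * B ^ 2 ≤ 8 * (ℓ + Q + 1) ^ 3 * (1 + y) := by
      calc 8 * A * B ^ 2 ≤ 8 * ((ℓ + Q + 1) * (1 + y)) * (ℓ + Q + 1) ^ 2 := by gcongr
        _ = _ := by ring
    have h10 : ℓ ^ 2 * y ^ 2 / (8 * (ℓ + Q + 1) ^ 3 * (1 + y)) ≤ ℓ ^ 2 * y ^ 2 / (8 * A * B ^ 2) := by
      gcongr
    refine le_trans ?_ h10
    have h11 : τ / 2 * (y - τ) ≤ y ^ 2 / (1 + y) := by
      rw [le_div_iff₀ (by linarith)]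
      nlinarith [mul_nonneg y0 (sub_nonneg.2 hτ1), mul_nonneg hτ.le y0, sq_nonneg (y - τ), mul_nonneg (sq_nonneg y) (sub_nonneg.2 hτ1), mul_nonneg (sq_nonneg τ) y0]
    calc ℓ ^ 2 / (8 * (ℓ + Q + 1) ^ 3) * τ / 2 * (y - τ)
        = ℓ ^ 2 / (8 * (ℓ + Q + 1) ^ 3) * (τ / 2 * (y - τ)) := by ring
      _ ≤ ℓ ^ 2 / (8 * (ℓ + Q + 1) ^ 3) * (y ^ 2 / (1 + y)) := by gcongr
      _ = _ := by field_simp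
  have e5 : σ ^ 2 * ℓ ^ 2 * y ^ 2 / (8 * A * B ^ 2) = σ ^ 2 * (ℓ ^ 2 * y ^ 2 / (8 * A * B ^ 2)) := by
    ring
  have s5 : σ ^ 2 * (q * (x - q) / (4 * ℓ) - Q ^ 3 / ℓ ^ 3 * σ ^ 2 * y
      + ℓ ^ 2 / (8 * (ℓ + Q + 1) ^ 3) * τ / 2 * (y - τ)) ≤
      σ ^ 2 * (1 / 4 * (q / B) * (x - q) + ℓ ^ 2 * y ^ 2 / (8 * A * B ^ 2)) := by
    gcongr
  have e6 : σ ^ 2 * (1 / 4 * (q / B) * (x - q) + ℓ ^ 2 * y ^ 2 / (8 * A * B ^ 2)) =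
    σ ^ 2 / 4 * (q / B) * (x - q) + σ ^ 2 * ℓ ^ 2 * y ^ 2 / (8 * A * B ^ 2) := by ring
  linarith

/-- Pointwise upper bound. -/
lemma pt_upper {ℓ b f : ℝ} (hl : 0 < ℓ) (hb : 0 ≤ b) (hf0 : ℓ / 2 ≤ f) (hfl : f ≤ ℓ) :
    Real.sqrt (f ^ 2 + b) ≤ f - ℓ + Real.sqrt (ℓ ^ 2 + b) + b * (ℓ - f) / ℓ ^ 2 := by
  set B := Real.sqrt (ℓ ^ 2 + b) with hB
  set D := Real.sqrt (f ^ 2 + b) with hD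
  have B2 : B ^ 2 = ℓ ^ 2 + b := Real.sq_sqrt (by positivity)
  have D2 : D ^ 2 = f ^ 2 + b := Real.sq_sqrt (by positivity)
  have hf : 0 < f := by linarith
  have Bl : ℓ ≤ B := Real.le_sqrt_of_sq_le (by linarith)
  have Df : f ≤ D := Real.le_sqrt_of_sq_le (by linarith)
  have hDB : B - D ≤ ℓ - f := by
    by_contra hcon
    push Not at hcon
    nlinarith
  have e1 : D - f = b / (D + f) := by
    rw [eq_div_iff (by linarith)]; linarith
  have e2 : B - ℓ = b / (B + ℓ) := by
    rw [eq_div_iff (by linarith)]; linarith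
  have e3 : b / (D + f) - b / (B + ℓ) = b * ((B + ℓ) - (D + f)) / ((D + f) * (B + ℓ)) := by
    have : D + f ≠ 0 := by linarith
    have : B + ℓ ≠ 0 := by linarith
    field_simp
  have h4 : b * ((B + ℓ) - (D + f)) / ((D + f) * (B + ℓ)) ≤ b * (2 * (ℓ - f)) / (2 * ℓ ^ 2) := by
    apply div_le_div₀
    · have : 0 ≤ ℓ - f := by linarith
      positivity
    · gcongr; linarith
    · positivity
    · nlinarith
  have e5 : b * (2 * (ℓ - f)) / (2 * ℓ ^ 2) = b * (ℓ - f) / ℓ ^ 2 := by field_simp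
  linarith

lemma prim_cont {η η' : ℝ → ℝ} (hi : IntervalIntegrable η' volume 0 1)
    (hp : ∀ t ∈ Icc (0:ℝ) 1, η t = ∫ u in (0:ℝ)..t, η' u) : ContinuousOn η (Icc 0 1) := by
  have := (hi.absolutelyContinuousOnInterval_intervalIntegral (c := 0) (by simp)).continuousOn
  rw [uIcc_of_le zero_le_one] at this
  exact this.congr hp

lemma ii_of {g : ℝ → ℝ} (h : IntegrableOn g (Icc 0 1)) : IntervalIntegrable g volume 0 1 :=
  (intervalIntegrable_iff_integrableOn_Icc_of_le zero_le_one).2 h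

lemma ii_to {g : ℝ → ℝ} (h : IntervalIntegrable g volume 0 1) : IntegrableOn g (Icc 0 1) :=
  (intervalIntegrable_iff_integrableOn_Icc_of_le zero_le_one).1 h

lemma etaE_admH (R : ℝ) : AdmissibleH (etaE R) (qE R) := by
  refine ⟨ii_to ((qE_cont R).intervalIntegrable _ _),
    ii_to (((qE_cont R).pow 2).intervalIntegrable _ _), etaE_prim R, ?_, etaE_zero R, etaE_one R⟩
  intro t _
  exact sq_nonneg _

lemma H_min {ℓ ℓ₁ R : ℝ} (hl : 0 < ℓ) (hR : 0 < R) (hR3 : R ^ 3 = 9 * (ℓ * ℓ₁) / 32) :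
    Hfun ℓ ℓ₁ (etaE R) (qE R) = minH ℓ ℓ₁ := by
  symm
  apply IsLeast.csInf_eq
  refine ⟨⟨_, _, etaE_admH R, rfl⟩, ?_⟩
  rintro x ⟨η, η', ⟨hi, hi2, hp, h0, -, h1⟩, rfl⟩
  have hI := ii_of hi
  have hI2 := ii_of hi2
  have hc := prim_cont hI hp
  have hsq : IntervalIntegrable (fun t => Real.sqrt (η t)) volume 0 1 := by
    apply ContinuousOn.intervalIntegrable
    rw [uIcc_of_le zero_le_one]
    exact Real.continuous_sqrt.comp_continuousOn hc
  have hsq2 : IntervalIntegrable (fun t => Real.sqrt (etaE R t)) volume 0 1 :=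
    (Real.continuous_sqrt.comp (etaE_cont R)).intervalIntegrable _ _
  have qI : IntervalIntegrable (qE R) volume 0 1 := (qE_cont R).intervalIntegrable _ _
  have qI2 : IntervalIntegrable (fun t => qE R t ^ 2) volume 0 1 :=
    ((qE_cont R).pow 2).intervalIntegrable _ _
  have hEL := EL hR hR3 η η' hI hp h0 h1
  have m1 : IntervalIntegrable (fun t => qE R t * (η' t - qE R t)) volume 0 1 :=
    (hI.sub qI).continuousOn_mul (qE_cont R).continuousOn
  have hmono : ∫ t in (0:ℝ)..1, ((-(ℓ₁ / ℓ) * Real.sqrt (etaE R t) + (qE R t) ^ 2 / (8 * ℓ ^ 2))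
      + 1 / (4 * ℓ ^ 2) * (qE R t * (η' t - qE R t) - 4 * (ℓ * ℓ₁) *
        (Real.sqrt (η t) - Real.sqrt (etaE R t)))) ≤ Hfun ℓ ℓ₁ η η' := by
    unfold Hfun
    apply intervalIntegral.integral_mono_on zero_le_one
    · exact ((hsq2.const_mul _).add (qI2.div_const _)).add
        ((m1.sub ((hsq.sub hsq2).const_mul _)).const_mul _)
    · exact (hsq.const_mul _).add (hI2.div_const _)
    · intro t _
      have : (-(ℓ₁ / ℓ) * Real.sqrt (η t) + (η' t) ^ 2 / (8 * ℓ ^ 2)) -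
        ((-(ℓ₁ / ℓ) * Real.sqrt (etaE R t) + (qE R t) ^ 2 / (8 * ℓ ^ 2))
      + 1 / (4 * ℓ ^ 2) * (qE R t * (η' t - qE R t) - 4 * (ℓ * ℓ₁) *
        (Real.sqrt (η t) - Real.sqrt (etaE R t)))) = (η' t - qE R t) ^ 2 / (8 * ℓ ^ 2) := by
        field_simp
        ring
      have : 0 ≤ (η' t - qE R t) ^ 2 / (8 * ℓ ^ 2) := by positivity
      linarith
  rw [intervalIntegral.integral_add ((hsq2.const_mul _).add (qI2.div_const _))
        ((m1.sub ((hsq.sub hsq2).const_mul _)).const_mul _),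
      intervalIntegral.integral_const_mul,
      intervalIntegral.integral_sub m1 ((hsq.sub hsq2).const_mul _),
      intervalIntegral.integral_const_mul] at hmono
  have : 0 ≤ 1 / (4 * ℓ ^ 2) * ((∫ t in (0:ℝ)..1, qE R t * (η' t - qE R t)) -
    4 * (ℓ * ℓ₁) * ∫ t in (0:ℝ)..1, (Real.sqrt (η t) - Real.sqrt (etaE R t))) := by
    apply mul_nonneg (by positivity)
    linarith
  unfold Hfun at hmono ⊢
  linarith

lemma f_bounds {ℓ ℓ₁ : ℝ} {f₁ : ℝ → ℝ} (hf : F1Hyp ℓ ℓ₁ f₁) {x : ℝ} (hx : 0 ≤ x) (hx1 : x ≤ 1) :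
    0 ≤ f₁ x ∧ f₁ x ≤ ℓ := by
  refine ⟨hf.nonneg x ⟨hx, hx1⟩, ?_⟩
  rw [← hf.f10]
  exact hf.anti.antitoneOn ⟨le_rfl, zero_le_one⟩ ⟨hx, hx1⟩ hx

lemma sqrt_mem {x : ℝ} (h : 0 ≤ x ∧ x ≤ 1) : Real.sqrt x ∈ Icc (0:ℝ) 1 :=
  ⟨Real.sqrt_nonneg _, Real.sqrt_le_one.2 h.2⟩

lemma fcomp_cont {ℓ ℓ₁ : ℝ} {f₁ : ℝ → ℝ} (hf : F1Hyp ℓ ℓ₁ f₁) {γ γ' : ℝ → ℝ}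
    (h : Admissible γ γ') : ContinuousOn (fun t => f₁ (Real.sqrt (γ t))) (Icc 0 1) := by
  obtain ⟨hi, hp, hb, -, -⟩ := h
  apply hf.cont.comp (Real.continuous_sqrt.comp_continuousOn (prim_cont (ii_of hi) hp))
  intro t ht
  exact sqrt_mem (hb t ht)

lemma energy_int {ℓ ℓ₁ : ℝ} {f₁ : ℝ → ℝ} (hf : F1Hyp ℓ ℓ₁ f₁) {s : ℝ} (hs : 0 < s) {γ γ' : ℝ → ℝ}
    (h : Admissible γ γ') : IntervalIntegrable
      (fun t => Real.sqrt (s ^ 2 * (f₁ (Real.sqrt (γ t))) ^ 2 + (γ' t) ^ 2 / 4)) volume 0 1 := by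
  apply ii_of
  have hc := fcomp_cont hf h
  have hm := hc.aestronglyMeasurable measurableSet_Icc (μ := volume)
  have hi := h.1
  have hdom : IntegrableOn (fun t => s * ℓ + |γ' t|) (Icc 0 1) :=
    (integrableOn_const (by simp)).add hi.abs
  refine Integrable.mono' hdom ?_ ?_
  · apply Real.continuous_sqrt.comp_aestronglyMeasurable
    have h2 := hi.aestronglyMeasurable
    exact ((hm.pow 2).const_mul _).add (by simpa [div_eq_mul_inv] using (h2.pow 2).mul_const (4:ℝ)⁻¹)
  · rw [ae_restrict_iff' measurableSet_Icc]
    refine ae_of_all _ ?_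
    intro t ht
    have hb := sqrt_mem (h.2.2.1 t ht)
    obtain ⟨f0, f1⟩ := f_bounds hf hb.1 hb.2
    rw [Real.norm_of_nonneg (Real.sqrt_nonneg _)]
    have hl := hf.hl
    apply Real.sqrt_le_iff.2
    refine ⟨by positivity, ?_⟩
    have : s * f₁ (Real.sqrt (γ t)) ≤ s * ℓ := by gcongr
    have h3 : (s * f₁ (Real.sqrt (γ t))) ^ 2 ≤ (s * ℓ) ^ 2 := by gcongr
    nlinarith [sq_abs (γ' t), abs_nonneg (γ' t), mul_nonneg hs.le hl.le,
      mul_nonneg (mul_nonneg hs.le hl.le) (abs_nonneg (γ' t))]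

lemma g0_le {f₁ : ℝ → ℝ} {s : ℝ} {γ γ' : ℝ → ℝ} (h : Admissible γ γ') :
    g0 f₁ s ≤ energy f₁ s γ γ' := by
  apply csInf_le
  · refine ⟨0, ?_⟩
    rintro x ⟨γ, γ', -, rfl⟩
    exact intervalIntegral.integral_nonneg zero_le_one (fun t _ => Real.sqrt_nonneg _)
  · exact ⟨_, _, h, rfl⟩

lemma prim_le {η η' : ℝ → ℝ} (hi : IntervalIntegrable η' volume 0 1)
    (hp : ∀ t ∈ Icc (0:ℝ) 1, η t = ∫ u in (0:ℝ)..t, η' u) (t : ℝ) (ht : t ∈ Icc (0:ℝ) 1) :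
    |η t| ≤ ∫ u in (0:ℝ)..1, |η' u| := by
  rw [hp t ht]
  refine (intervalIntegral.abs_integral_le_integral_abs ht.1).trans ?_
  apply intervalIntegral.integral_mono_interval le_rfl ht.1 ht.2
  · exact ae_of_all _ (fun u => abs_nonneg _)
  · exact hi.abs

lemma zero_adm : Admissible (fun _ => 0) (fun _ => 0) := by
  refine ⟨integrableOn_const (by simp), ?_, ?_, rfl, rfl⟩
  · intro t _; simp
  · intro t _; simp

/-- A priori smallness of minimizers. -/
lemma gamma_small {ℓ ℓ₁ : ℝ} {f₁ : ℝ → ℝ} (hf : F1Hyp ℓ ℓ₁ f₁) {s : ℝ} (hs : 0 < s) {γ γ' : ℝ → ℝ}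
    (h : Admissible γ γ') (he : energy f₁ s γ γ' = g0 f₁ s) (t : ℝ) (ht : t ∈ Icc (0:ℝ) 1) :
    γ t ≤ 2 * (s * ℓ) := by
  have h1 : energy f₁ s (fun _ => 0) (fun _ => 0) = s * ℓ := by
    simp only [energy, Real.sqrt_zero, hf.f10]
    have : Real.sqrt (s ^ 2 * ℓ ^ 2 + 0 ^ 2 / 4) = s * ℓ := by
      rw [show s ^ 2 * ℓ ^ 2 + (0:ℝ) ^ 2 / 4 = (s * ℓ) ^ 2 by ring]
      exact Real.sqrt_sq (mul_nonneg hs.le hf.hl.le)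
    rw [this]; simp
  have h2 := g0_le (f₁ := f₁) (s := s) zero_adm
  have h3 := prim_le (ii_of h.1) h.2.1 t ht
  have h4 : ∫ u in (0:ℝ)..1, |γ' u| / 2 ≤ energy f₁ s γ γ' := by
    apply intervalIntegral.integral_mono_on zero_le_one ((ii_of h.1).abs.div_const 2)
      (energy_int hf hs h)
    intro u _
    apply Real.le_sqrt_of_sq_le
    nlinarith [sq_abs (γ' u), sq_nonneg (s * f₁ (Real.sqrt (γ u)))]
  rw [intervalIntegral.integral_div] at h4
  linarith [le_abs_self (γ t)]

lemma f_expand {ℓ ℓ₁ : ℝ} {f₁ : ℝ → ℝ} (hf : F1Hyp ℓ ℓ₁ f₁) {δ : ℝ} (hδ : 0 < δ) :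
    ∃ ρ : ℝ, 0 < ρ ∧ ρ ≤ 1 ∧ ∀ x, 0 ≤ x → x ≤ ρ →
      ℓ - (ℓ₁ + δ) * x ≤ f₁ x ∧ f₁ x ≤ ℓ - (ℓ₁ - δ) * x := by
  have h := hf.lim0
  rw [Metric.tendsto_nhdsWithin_nhds] at h
  obtain ⟨r, hr, h⟩ := h δ hδ
  refine ⟨min (r / 2) 1, by positivity, min_le_right _ _, ?_⟩
  intro x hx hxr
  rcases hx.eq_or_lt with rfl | hx
  · simp [hf.f10]
  have h1 : x ≤ r / 2 := hxr.trans (min_le_left _ _)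
  have := h (x := x) hx (by rw [Real.dist_eq, sub_zero, abs_of_pos hx]; linarith)
  rw [Real.dist_eq, sub_zero, abs_div, abs_of_pos hx, div_lt_iff₀ hx, abs_lt] at this
  constructor <;> nlinarith

set_option maxHeartbeats 2000000 in
lemma core {ℓ ℓ₁ R σ τ δ ρ : ℝ} {f₁ : ℝ → ℝ} (hf : F1Hyp ℓ ℓ₁ f₁) (hR : 0 < R)
    (hR3 : R ^ 3 = 9 * (ℓ * ℓ₁) / 32) (hσ : 0 < σ) (hσ1 : σ ≤ 1) (hτ : 0 < τ) (hτ1 : τ ≤ 1)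
    (hδ : 0 < δ) (hδ1 : δ ≤ 1) (hρ : 0 < ρ) (hρ1 : ρ ≤ 1)
    (hexp : ∀ x, 0 ≤ x → x ≤ ρ → ℓ - (ℓ₁ + δ) * x ≤ f₁ x ∧ f₁ x ≤ ℓ - (ℓ₁ - δ) * x)
    (hρl : (ℓ₁ + δ) * ρ ≤ ℓ / 2) (hσR : σ ^ 2 * R ≤ ρ) (hσl : 2 * (σ ^ 3 * ℓ) ≤ ρ ^ 2)
    {γ γ' : ℝ → ℝ} (h : Admissible γ γ') (he : energy f₁ (σ ^ 3) γ γ' = g0 f₁ (σ ^ 3)) :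
    (ℓ ^ 2 / (8 * (ℓ + 16 / 3 * R ^ 2 + 1) ^ 3) * τ / 2 - (16 / 3 * R ^ 2) ^ 3 / ℓ ^ 3 * σ ^ 2 - δ)
      * (∫ t in (0:ℝ)..1, |γ' t / σ ^ 4 - qE R t|) ≤
    ℓ ^ 2 / (8 * (ℓ + 16 / 3 * R ^ 2 + 1) ^ 3) * τ ^ 2 / 2 + δ * (1 + R + R ^ 2)
      + σ ^ 2 * ((16 / 3 * R ^ 2) ^ 2 / 4 * (ℓ₁ + 1) * R / ℓ ^ 2) := by
  have hl := hf.hl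
  have hl1 := hf.hl1
  obtain ⟨Q, hQ⟩ : ∃ Q, Q = 16 / 3 * R ^ 2 := ⟨_, rfl⟩
  rw [← hQ]
  obtain ⟨c, hc⟩ : ∃ c, c = ℓ ^ 2 / (8 * (ℓ + Q + 1) ^ 3) := ⟨_, rfl⟩
  rw [← hc]
  obtain ⟨C1, hC1⟩ : ∃ C1, C1 = Q ^ 3 / ℓ ^ 3 := ⟨_, rfl⟩
  rw [← hC1]
  have hs : 0 < σ ^ 3 := by positivity
  have hσ4 : 0 < σ ^ 4 := by positivity
  have hqQ : ∀ t, |qE R t| ≤ Q := fun t => hQ ▸ qE_le R t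
  have hQ0 : 0 ≤ Q := (abs_nonneg _).trans (hqQ 0)
  -- the rescaled function
  obtain ⟨η, hη⟩ : ∃ η : ℝ → ℝ, η = fun t => γ t / σ ^ 4 := ⟨_, rfl⟩
  obtain ⟨η', hη'⟩ : ∃ η' : ℝ → ℝ, η' = fun t => γ' t / σ ^ 4 := ⟨_, rfl⟩
  have hgη : ∀ t, γ t = σ ^ 4 * η t := by intro t; rw [hη]; field_simp
  have hgη' : ∀ t, γ' t = σ ^ 4 * η' t := by intro t; rw [hη']; field_simp
  have hI : IntervalIntegrable η' volume 0 1 := by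
    rw [hη']; exact (ii_of h.1).div_const _
  have hp : ∀ t ∈ Icc (0:ℝ) 1, η t = ∫ u in (0:ℝ)..t, η' u := by
    intro t ht
    rw [hη, hη']
    simp only
    rw [intervalIntegral.integral_div, h.2.1 t ht]
  have h0 : ∀ t ∈ Icc (0:ℝ) 1, 0 ≤ η t := by
    intro t ht
    rw [hη]
    exact div_nonneg (h.2.2.1 t ht).1 hσ4.le
  have h1 : η 1 = 0 := by rw [hη]; simp [h.2.2.2.2]
  have hEL := EL hR hR3 η η' hI hp h0 h1
  have hηc := prim_cont hI hp
  have hsq : IntervalIntegrable (fun t => Real.sqrt (η t)) volume 0 1 := by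
    apply ContinuousOn.intervalIntegrable
    rw [uIcc_of_le zero_le_one]
    exact Real.continuous_sqrt.comp_continuousOn hηc
  have hsq2 : IntervalIntegrable (fun t => Real.sqrt (etaE R t)) volume 0 1 :=
    (Real.continuous_sqrt.comp (etaE_cont R)).intervalIntegrable _ _
  have qI : IntervalIntegrable (qE R) volume 0 1 := (qE_cont R).intervalIntegrable _ _
  have m1 : IntervalIntegrable (fun t => qE R t * (η' t - qE R t)) volume 0 1 :=
    (hI.sub qI).continuousOn_mul (qE_cont R).continuousOn
  have my : IntervalIntegrable (fun t => |η' t - qE R t|) volume 0 1 := (hI.sub qI).abs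
  have hBc : Continuous (fun t => Real.sqrt (ℓ ^ 2 + σ ^ 2 * qE R t ^ 2 / 4)) := by
    have := qE_cont R
    fun_prop
  have mB : IntervalIntegrable (fun t => Real.sqrt (ℓ ^ 2 + σ ^ 2 * qE R t ^ 2 / 4)) volume 0 1 :=
    hBc.intervalIntegrable _ _
  have hYeq : (∫ t in (0:ℝ)..1, |γ' t / σ ^ 4 - qE R t|) = ∫ t in (0:ℝ)..1, |η' t - qE R t| := by
    rw [hη']
  rw [hYeq]
  obtain ⟨Y, hY⟩ : ∃ Y, Y = ∫ t in (0:ℝ)..1, |η' t - qE R t| := ⟨_, rfl⟩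
  rw [← hY]
  -- sup bound
  have hsup : ∀ t ∈ Icc (0:ℝ) 1, |η t - etaE R t| ≤ Y := by
    rw [hY]
    refine prim_le (η := fun t => η t - etaE R t) (hI.sub qI) ?_
    intro t ht
    have hsub : uIcc 0 t ⊆ uIcc (0:ℝ) 1 := by
      rw [uIcc_of_le ht.1, uIcc_of_le zero_le_one]
      exact Icc_subset_Icc_right ht.2
    rw [intervalIntegral.integral_sub (hI.mono_set hsub) (qI.mono_set hsub)]
    simp only [hp t ht, etaE_prim R t ht]
  have hw : ∀ t, 0 ≤ R * (1 - zf t ^ 2) ∧ R * (1 - zf t ^ 2) ≤ R := by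
    intro t
    have := zf_sq_le t
    constructor
    · exact mul_nonneg hR.le (by linarith)
    · nlinarith [sq_nonneg (zf t)]
  have hetaE : ∀ t, etaE R t ≤ R ^ 2 := by
    intro t
    unfold etaE
    exact pow_le_pow_left₀ (hw t).1 (hw t).2 2
  have hsqb : ∫ t in (0:ℝ)..1, Real.sqrt (η t) ≤ 1 + R ^ 2 + Y := by
    have : ∫ t in (0:ℝ)..1, Real.sqrt (η t) ≤ ∫ t in (0:ℝ)..1, (1 + R ^ 2 + Y) := by
      apply intervalIntegral.integral_mono_on zero_le_one hsq intervalIntegrable_const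
      intro t ht
      have a1 := (abs_le.1 (hsup t ht)).2
      have a2 := hetaE t
      have a3 := Real.sq_sqrt (h0 t ht)
      nlinarith [sq_nonneg (Real.sqrt (η t) - 1)]
    simpa using this
  -- lower bound for the energy
  have hlow : ∫ t in (0:ℝ)..1, (Real.sqrt (ℓ ^ 2 + σ ^ 2 * qE R t ^ 2 / 4) + σ ^ 2 *
      (1 / (4 * ℓ) * (qE R t * (η' t - qE R t)) - (ℓ₁ + δ) * Real.sqrt (η t) +
        (c * τ / 2 - C1 * σ ^ 2) * |η' t - qE R t| - c * τ ^ 2 / 2)) ≤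
      energy f₁ (σ ^ 3) γ γ' / σ ^ 3 := by
    unfold energy
    rw [← intervalIntegral.integral_div]
    apply intervalIntegral.integral_mono_on zero_le_one
    · exact mB.add (((((m1.const_mul _).sub (hsq.const_mul _)).add (my.const_mul _)).sub
        intervalIntegrable_const).const_mul _)
    · exact (energy_int hf hs h).div_const _
    · intro t ht
      have hb := sqrt_mem (h.2.2.1 t ht)
      obtain ⟨f0, f1⟩ := f_bounds hf hb.1 hb.2
      have hsm : Real.sqrt (γ t) ≤ ρ := by
        apply Real.sqrt_le_iff.2
        refine ⟨hρ.le, ?_⟩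
        linarith [gamma_small hf hs h he t ht]
      have hx := (hexp _ hb.1 hsm).1
      have hsγ : Real.sqrt (γ t) = σ ^ 2 * Real.sqrt (η t) := by
        rw [hgη t, show σ ^ 4 * η t = (σ ^ 2) ^ 2 * η t by ring, Real.sqrt_mul (by positivity),
          Real.sqrt_sq (by positivity)]
      have hpt := pt_lower (x := η' t) hl (hqQ t) hσ hσ1 f0 f1 hτ hτ1
      have hE : Real.sqrt ((σ ^ 3) ^ 2 * f₁ (Real.sqrt (γ t)) ^ 2 + γ' t ^ 2 / 4) / σ ^ 3 =
          Real.sqrt (f₁ (Real.sqrt (γ t)) ^ 2 + σ ^ 2 * η' t ^ 2 / 4) := by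
        rw [hgη' t, show (σ ^ 3) ^ 2 * f₁ (Real.sqrt (γ t)) ^ 2 + (σ ^ 4 * η' t) ^ 2 / 4 =
          (σ ^ 3) ^ 2 * (f₁ (Real.sqrt (γ t)) ^ 2 + σ ^ 2 * η' t ^ 2 / 4) by ring,
          Real.sqrt_mul (by positivity), Real.sqrt_sq (by positivity)]
        field_simp
      rw [hE]
      refine le_trans ?_ hpt
      rw [hsγ] at hx
      rw [← hc, ← hC1, hsγ]
      have e1 : qE R t * (η' t - qE R t) / (4 * ℓ) = 1 / (4 * ℓ) * (qE R t * (η' t - qE R t)) := by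
        ring
      rw [e1]
      linarith
  -- upper bound by the competitor
  have hcomp : Admissible (fun t => σ ^ 4 * etaE R t) (fun t => σ ^ 4 * qE R t) := by
    refine ⟨ii_to (qI.const_mul _), ?_, ?_, by simp [etaE_zero], by simp [etaE_one]⟩
    · intro t ht
      simp only
      rw [intervalIntegral.integral_const_mul, etaE_prim R t ht]
    · intro t ht
      have e1 : σ ^ 4 * etaE R t ≤ (σ ^ 2 * R) ^ 2 := by
        calc σ ^ 4 * etaE R t ≤ σ ^ 4 * R ^ 2 := by gcongr; exact hetaE t
          _ = _ := by ring
      have e2 : (σ ^ 2 * R) ^ 2 ≤ 1 := by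
        apply pow_le_one₀ (by positivity); linarith
      exact ⟨mul_nonneg hσ4.le (sq_nonneg _), e1.trans e2⟩
  have hup : energy f₁ (σ ^ 3) (fun t => σ ^ 4 * etaE R t) (fun t => σ ^ 4 * qE R t) / σ ^ 3 ≤
      ∫ t in (0:ℝ)..1, (Real.sqrt (ℓ ^ 2 + σ ^ 2 * qE R t ^ 2 / 4) + σ ^ 2 *
        (-ℓ₁ * Real.sqrt (etaE R t) + (δ * R + σ ^ 2 * (Q ^ 2 / 4 * (ℓ₁ + 1) * R / ℓ ^ 2)))) := by
    unfold energy
    rw [← intervalIntegral.integral_div]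
    apply intervalIntegral.integral_mono_on zero_le_one
    · exact (energy_int hf hs hcomp).div_const _
    · exact mB.add (((hsq2.const_mul _).add intervalIntegrable_const).const_mul _)
    · intro t ht
      have hb := sqrt_mem (hcomp.2.2.1 t ht)
      obtain ⟨f0, f1⟩ := f_bounds hf hb.1 hb.2
      simp only at hb f0 f1
      have hsγ : Real.sqrt (σ ^ 4 * etaE R t) = σ ^ 2 * Real.sqrt (etaE R t) := by
        rw [show σ ^ 4 * etaE R t = (σ ^ 2) ^ 2 * etaE R t by ring, Real.sqrt_mul (by positivity),
          Real.sqrt_sq (by positivity)]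
      have hE : Real.sqrt ((σ ^ 3) ^ 2 * f₁ (Real.sqrt (σ ^ 4 * etaE R t)) ^ 2 +
          (σ ^ 4 * qE R t) ^ 2 / 4) / σ ^ 3 =
          Real.sqrt (f₁ (Real.sqrt (σ ^ 4 * etaE R t)) ^ 2 + σ ^ 2 * qE R t ^ 2 / 4) := by
        rw [show (σ ^ 3) ^ 2 * f₁ (Real.sqrt (σ ^ 4 * etaE R t)) ^ 2 + (σ ^ 4 * qE R t) ^ 2 / 4 =
          (σ ^ 3) ^ 2 * (f₁ (Real.sqrt (σ ^ 4 * etaE R t)) ^ 2 + σ ^ 2 * qE R t ^ 2 / 4) by ring,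
          Real.sqrt_mul (by positivity), Real.sqrt_sq (by positivity)]
        field_simp
      rw [hE]
      rw [hsγ] at hb f0 f1 ⊢
      rw [etaE_sqrt hR] at hb f0 f1 ⊢
      obtain ⟨w0, wR⟩ := hw t
      set w := R * (1 - zf t ^ 2) with hwd
      have hsm : σ ^ 2 * w ≤ ρ := by
        refine le_trans ?_ hσR
        gcongr
      obtain ⟨x1, x2⟩ := hexp _ hb.1 hsm
      set F := f₁ (σ ^ 2 * w) with hF
      have hF2 : ℓ / 2 ≤ F := by
        have : (ℓ₁ + δ) * (σ ^ 2 * w) ≤ (ℓ₁ + δ) * ρ := by gcongr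
        linarith
      have hpt := pt_upper (b := σ ^ 2 * qE R t ^ 2 / 4) hl (by positivity) hF2 f1
      refine hpt.trans ?_
      have q2 : qE R t ^ 2 ≤ Q ^ 2 := by
        rw [← sq_abs]; gcongr; exact hqQ t
      have e4 : σ ^ 2 * qE R t ^ 2 / 4 * (ℓ - F) / ℓ ^ 2 ≤
          σ ^ 2 * Q ^ 2 / 4 * ((ℓ₁ + 1) * (σ ^ 2 * R)) / ℓ ^ 2 := by
        have : ℓ - F ≤ (ℓ₁ + 1) * (σ ^ 2 * R) := by
          calc ℓ - F ≤ (ℓ₁ + δ) * (σ ^ 2 * w) := by linarith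
            _ ≤ (ℓ₁ + 1) * (σ ^ 2 * R) := by gcongr
        have : 0 ≤ ℓ - F := by linarith
        gcongr
      have e5 : σ ^ 2 * Q ^ 2 / 4 * ((ℓ₁ + 1) * (σ ^ 2 * R)) / ℓ ^ 2 =
        σ ^ 2 * (σ ^ 2 * (Q ^ 2 / 4 * (ℓ₁ + 1) * R / ℓ ^ 2)) := by ring
      have e6 : δ * (σ ^ 2 * w) ≤ δ * (σ ^ 2 * R) := by gcongr
      linarith
  have hmain := g0_le (f₁ := f₁) (s := σ ^ 3) hcomp
  rw [← he] at hmain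
  have hmain2 := (hlow.trans (div_le_div_of_nonneg_right hmain hs.le)).trans hup
  rw [intervalIntegral.integral_add mB (((((m1.const_mul _).sub (hsq.const_mul _)).add
      (my.const_mul _)).sub intervalIntegrable_const).const_mul _),
    intervalIntegral.integral_add mB (((hsq2.const_mul _).add intervalIntegrable_const).const_mul _),
    intervalIntegral.integral_const_mul, intervalIntegral.integral_const_mul,
    intervalIntegral.integral_sub (((m1.const_mul _).sub (hsq.const_mul _)).add
      (my.const_mul _)) intervalIntegrable_const,
    intervalIntegral.integral_add ((m1.const_mul _).sub (hsq.const_mul _)) (my.const_mul _),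
    intervalIntegral.integral_sub (m1.const_mul _) (hsq.const_mul _),
    intervalIntegral.integral_add (hsq2.const_mul _) intervalIntegrable_const,
    intervalIntegral.integral_const_mul, intervalIntegral.integral_const_mul,
    intervalIntegral.integral_const_mul, intervalIntegral.integral_const_mul,
    intervalIntegral.integral_const, intervalIntegral.integral_const, ← hY] at hmain2
  simp only [sub_zero, one_smul, add_le_add_iff_left] at hmain2
  have hmain3 := le_of_mul_le_mul_left hmain2 (by positivity)
  rw [intervalIntegral.integral_sub hsq hsq2] at hEL
  have hEL2 : ℓ₁ * ((∫ t in (0:ℝ)..1, Real.sqrt (η t)) - ∫ t in (0:ℝ)..1, Real.sqrt (etaE R t)) ≤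
      1 / (4 * ℓ) * ∫ t in (0:ℝ)..1, qE R t * (η' t - qE R t) := by
    rw [one_div, ← div_eq_inv_mul, le_div_iff₀ (by positivity)]
    linarith
  have hδs := mul_le_mul_of_nonneg_left hsqb hδ.le
  linarith

set_option maxHeartbeats 2000000 in
/-- the rescaled minimizers `s^{-4/3} γ_s` converge uniformly on `[0,1]`
to the unique minimizer `η̄` of `H` as `s → 0⁺`. -/
theorem stmt_12 (ℓ ℓ₁ : ℝ) (f₁ : ℝ → ℝ) (hf : F1Hyp ℓ ℓ₁ f₁)
    (ηb ηb' : ℝ → ℝ) (hb : AdmissibleH ηb ηb')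
    (hbmin : Hfun ℓ ℓ₁ ηb ηb' = minH ℓ ℓ₁)
    (hbuniq : ∀ ζ ζ' : ℝ → ℝ, AdmissibleH ζ ζ' → Hfun ℓ ℓ₁ ζ ζ' = minH ℓ ℓ₁ →
      ∀ t ∈ Icc (0:ℝ) 1, ζ t = ηb t) :
    ∀ ε : ℝ, 0 < ε → ∃ s₀ : ℝ, 0 < s₀ ∧ ∀ s : ℝ, 0 < s → s < s₀ → g0 f₁ s < 1 →
      ∀ γ γ' : ℝ → ℝ, Admissible γ γ' → energy f₁ s γ γ' = g0 f₁ s →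
        ∀ t ∈ Icc (0:ℝ) 1, |γ t / s ^ ((4:ℝ)/3) - ηb t| < ε := by
  intro ε hε
  have hl := hf.hl
  have hl1 := hf.hl1
  obtain ⟨R, hR, hR3⟩ : ∃ R : ℝ, 0 < R ∧ R ^ 3 = 9 * (ℓ * ℓ₁) / 32 := by
    refine ⟨(9 * (ℓ * ℓ₁) / 32) ^ ((1:ℝ)/3), by positivity, ?_⟩
    rw [← Real.rpow_natCast, ← Real.rpow_mul (by positivity)]
    norm_num
  have hηb := hbuniq _ _ (etaE_admH R) (H_min hl hR hR3)
  obtain ⟨c, hc⟩ : ∃ c, c = ℓ ^ 2 / (8 * (ℓ + 16 / 3 * R ^ 2 + 1) ^ 3) := ⟨_, rfl⟩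
  obtain ⟨C1, hC1⟩ : ∃ C1, C1 = (16 / 3 * R ^ 2) ^ 3 / ℓ ^ 3 := ⟨_, rfl⟩
  obtain ⟨C2, hC2⟩ : ∃ C2, C2 = (16 / 3 * R ^ 2) ^ 2 / 4 * (ℓ₁ + 1) * R / ℓ ^ 2 := ⟨_, rfl⟩
  have c0 : 0 < c := by rw [hc]; positivity
  have C10 : 0 < C1 := by rw [hC1]; positivity
  have C20 : 0 < C2 := by rw [hC2]; positivity
  obtain ⟨τ, hτ, hτ1, hτε⟩ : ∃ τ : ℝ, 0 < τ ∧ τ ≤ 1 ∧ 3 * τ < ε :=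
    ⟨min 1 (ε / 4), by positivity, min_le_left _ _, by linarith [min_le_right 1 (ε / 4)]⟩
  have small : ∀ a b : ℝ, 0 < a → 0 < b → ∀ᶠ x : ℝ in nhdsWithin 0 (Ioi 0), a * x ≤ b := by
    intro a b ha hb
    have : ∀ᶠ x : ℝ in nhds 0, x < b / a := eventually_lt_nhds (by positivity)
    filter_upwards [this.filter_mono nhdsWithin_le_nhds] with x hx
    rw [lt_div_iff₀ ha] at hx
    linarith
  have hpos : ∀ᶠ x : ℝ in nhdsWithin 0 (Ioi 0), 0 < x := eventually_mem_nhdsWithin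
  obtain ⟨δ, hδ, hδ1, hδ2, hδ3⟩ : ∃ δ : ℝ, 0 < δ ∧ 1 * δ ≤ 1 ∧ 1 * δ ≤ c * τ / 8 ∧
      (1 + R + R ^ 2) * δ ≤ c * τ ^ 2 / 8 :=
    (hpos.and ((small 1 1 one_pos one_pos).and ((small 1 (c * τ / 8) one_pos (by positivity)).and
      (small (1 + R + R ^ 2) (c * τ ^ 2 / 8) (by positivity) (by positivity))))).exists
  obtain ⟨ρ₀, hρ₀, hρ₀1, hexp⟩ := f_expand hf hδ
  obtain ⟨ρ, hρ, hρρ, hρl⟩ : ∃ ρ : ℝ, 0 < ρ ∧ 1 * ρ ≤ ρ₀ ∧ (ℓ₁ + δ) * ρ ≤ ℓ / 2 :=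
    (hpos.and ((small 1 ρ₀ one_pos hρ₀).and
      (small (ℓ₁ + δ) (ℓ / 2) (by positivity) (by positivity)))).exists
  obtain ⟨σ₀, hσ₀, k1, k2, k3, k4, k5⟩ : ∃ σ₀ : ℝ, 0 < σ₀ ∧ 1 * σ₀ ≤ 1 ∧ C1 * σ₀ ≤ c * τ / 8 ∧
      C2 * σ₀ ≤ c * τ ^ 2 / 8 ∧ R * σ₀ ≤ ρ ∧ (2 * ℓ) * σ₀ ≤ ρ ^ 2 :=
    (hpos.and ((small 1 1 one_pos one_pos).and ((small C1 (c * τ / 8) C10 (by positivity)).and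
      ((small C2 (c * τ ^ 2 / 8) C20 (by positivity)).and ((small R ρ hR hρ).and
        (small (2 * ℓ) (ρ ^ 2) (by positivity) (by positivity))))))).exists
  refine ⟨σ₀ ^ 3, by positivity, ?_⟩
  intro s hs hss _ γ γ' h he t ht
  obtain ⟨σ, hσ, hσs⟩ : ∃ σ : ℝ, 0 < σ ∧ σ ^ 3 = s := by
    refine ⟨s ^ ((1:ℝ)/3), by positivity, ?_⟩
    rw [← Real.rpow_natCast, ← Real.rpow_mul hs.le]
    norm_num
  have hs4 : s ^ ((4:ℝ)/3) = σ ^ 4 := by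
    rw [← hσs, ← Real.rpow_natCast, ← Real.rpow_mul hσ.le, ← Real.rpow_natCast]
    norm_num
  subst hσs
  have hσσ : σ ≤ σ₀ := (lt_of_pow_lt_pow_left₀ 3 hσ₀.le hss).le
  have hσ1 : σ ≤ 1 := by linarith
  have p2 : σ ^ 2 ≤ σ₀ := by nlinarith
  have p3 : σ ^ 3 ≤ σ₀ := by
    have : σ ^ 3 ≤ σ ^ 2 := pow_le_pow_of_le_one hσ.le hσ1 (by norm_num)
    linarith
  have hcore := core hf hR hR3 hσ hσ1 hτ hτ1 hδ (by linarith) hρ (by linarith)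
    (fun x hx hx2 => hexp x hx (by linarith)) hρl
    (by nlinarith [mul_le_mul_of_nonneg_left p2 hR.le])
    (by nlinarith [mul_le_mul_of_nonneg_left p3 hl.le]) h he
  rw [← hc, ← hC1, ← hC2] at hcore
  have qI : IntervalIntegrable (qE R) volume 0 1 := (qE_cont R).intervalIntegrable _ _
  have gI : IntervalIntegrable (fun t => γ' t / σ ^ 4) volume 0 1 := (ii_of h.1).div_const _
  have hsup := prim_le (η := fun t => γ t / σ ^ 4 - etaE R t)
    (η' := fun t => γ' t / σ ^ 4 - qE R t) (gI.sub qI) (by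
      intro t ht
      have hsub : uIcc 0 t ⊆ uIcc (0:ℝ) 1 := by
        rw [uIcc_of_le ht.1, uIcc_of_le zero_le_one]
        exact Icc_subset_Icc_right ht.2
      rw [intervalIntegral.integral_sub (gI.mono_set hsub) (qI.mono_set hsub)]
      simp only [intervalIntegral.integral_div, h.2.1 t ht, etaE_prim R t ht]) t ht
  rw [hs4, ← hηb t ht]
  refine lt_of_le_of_lt hsup ?_
  set Y := ∫ t in (0:ℝ)..1, |γ' t / σ ^ 4 - qE R t| with hY
  have Y0 : 0 ≤ Y := (abs_nonneg _).trans hsup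
  have b1 : C1 * σ ^ 2 ≤ c * τ / 8 := (mul_le_mul_of_nonneg_left p2 C10.le).trans k2
  have b2 : C2 * σ ^ 2 ≤ c * τ ^ 2 / 8 := (mul_le_mul_of_nonneg_left p2 C20.le).trans k3
  have b3 : c * τ / 4 * Y ≤ (c * τ / 2 - C1 * σ ^ 2 - δ) * Y := by
    apply mul_le_mul_of_nonneg_right _ Y0
    linarith
  have b4 : c * τ / 4 * Y ≤ c * τ / 4 * (3 * τ) := by
    linarith
  have := le_of_mul_le_mul_left b4 (by positivity)
  linarith
end

section
/- Let s ≥ 0 with g₀(s) < 1. Then the infimum defining g₀(s) is attained: there exists (α,β) ∈ 𝒰₁ with 𝒢_s(α,β) = g₀(s). Moreover, every (α,β) ∈ 𝒰₁ with 𝒢_s(α,β) = g₀(s) satisfies β(t) ≥ 1 − √(g₀(s)) for every t ∈ ℝ. -/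
open MeasureTheory Set Filter
open scoped ENNReal

/-- Hypotheses on the functions `f` and `f₁` from Section 6.1 of the paper.
`f : [0,1] → [0,∞]` is real-valued, `C¹` and nondecreasing on `[0,1)` with `f(1) = ∞`,
`f(t) = 0` iff `t = 0`, and `f₁(s) = s·f(1−s)` (with `f₁(0) = ℓ`) is strictly decreasing,
`u ↦ f₁(√u)` is convex, and `f₁(s) = ℓ − ℓ₁ s + o(s)` as `s → 0⁺`. -/
structure FHyp (ℓ ℓ₁ : ℝ) (f : ℝ → ℝ≥0∞) (f₁ : ℝ → ℝ) : Prop where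
  hl : 0 < ℓ
  hl1 : 0 < ℓ₁
  freal : ∀ t ∈ Ico (0:ℝ) 1, f t ≠ ⊤
  fdiff : ∃ d : ℝ → ℝ, ContinuousOn d (Ico 0 1) ∧
    ∀ t ∈ Ico (0:ℝ) 1, HasDerivWithinAt (fun x => (f x).toReal) (d t) (Ico 0 1) t
  fmono : MonotoneOn (fun x => (f x).toReal) (Ico 0 1)
  fzero : ∀ t ∈ Icc (0:ℝ) 1, (f t = 0 ↔ t = 0)
  ftop : f 1 = ⊤
  hf₁ : ∀ s ∈ Ioc (0:ℝ) 1, f₁ s = s * (f (1 - s)).toReal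
  hf₁0 : f₁ 0 = ℓ
  f₁anti : StrictAntiOn f₁ (Icc 0 1)
  convexSqrt : ConvexOn ℝ (Icc 0 1) (fun u => f₁ (Real.sqrt u))
  lim0 : Tendsto (fun s => (f₁ s - ℓ + ℓ₁ * s) / s) (nhdsWithin 0 (Ioi 0)) (nhds 0)

/-- `u` is locally absolutely continuous on `ℝ` with a.e. derivative `u'`. -/
def LocAC (u u' : ℝ → ℝ) : Prop :=
  (∀ a b : ℝ, IntegrableOn u' (Icc a b)) ∧
  ∀ a t : ℝ, u t = u a + ∫ x in a..t, u' x

/-- Membership of the pair `(α, β)` (with a.e. derivatives `α', β'`) in the class `𝒰₁`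
of (6.8): `α' ∈ L¹(ℝ)`, `|∫ α'| = 1`, `0 ≤ β ≤ 1`, and `β(t) → 1` as `|t| → ∞`. -/
def MemU1 (α α' β β' : ℝ → ℝ) : Prop :=
  LocAC α α' ∧ LocAC β β' ∧
  Integrable α' ∧ |∫ t : ℝ, α' t| = 1 ∧
  (∀ t : ℝ, 0 ≤ β t ∧ β t ≤ 1) ∧
  Tendsto β atTop (nhds 1) ∧ Tendsto β atBot (nhds 1)

/-- The functional `𝒢_s` of (6.7), with values in `[0,∞]` and the convention `∞·0 = 0`. -/
noncomputable def Gfun (f : ℝ → ℝ≥0∞) (s : ℝ) (α' β β' : ℝ → ℝ) : ℝ≥0∞ :=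
  ∫⁻ t : ℝ, (ENNReal.ofReal (s ^ 2 * (α' t) ^ 2) * (f (β t)) ^ 2
    + ENNReal.ofReal ((1 - β t) ^ 2 / 4 + (β' t) ^ 2))

/-- The cohesive energy density `g₀` of pristine material, definition (6.6). -/
noncomputable def g0E (f : ℝ → ℝ≥0∞) (s : ℝ) : ℝ≥0∞ :=
  sInf {x | ∃ α α' β β' : ℝ → ℝ, MemU1 α α' β β' ∧ x = Gfun f s α' β β'}

lemma LocAC.intervalIntegrable {u u' : ℝ → ℝ} (h : LocAC u u') (a b : ℝ) :
    IntervalIntegrable u' volume a b := by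
  rw [intervalIntegrable_iff]
  exact (h.1 (min a b) (max a b)).mono_set Ioc_subset_Icc_self


lemma LocAC.continuous {u u' : ℝ → ℝ} (h : LocAC u u') : Continuous u := by
  have : u = fun t => u 0 + ∫ x in (0:ℝ)..t, u' x := by
    funext t; exact h.2 0 t
  rw [this]
  refine continuous_const.add ?_
  apply intervalIntegral.continuous_primitive
  intro a b
  exact h.intervalIntegrable a b

lemma LocAC.locallyIntegrable {u u' : ℝ → ℝ} (h : LocAC u u') :
    LocallyIntegrable u' volume := by
  intro x
  exact ⟨Icc (x-1) (x+1), Icc_mem_nhds (by linarith) (by linarith), h.1 _ _⟩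

lemma LocAC.chain {u u' p P : ℝ → ℝ} (h : LocAC u u') (K : NNReal) (hP : LipschitzWith K P)
    (hPp : ∀ x, HasDerivAt P (p x) x) (a b : ℝ) :
    ∫ t in a..b, p (u t) * u' t = P (u b) - P (u a) := by
  have hac : AbsolutelyContinuousOnInterval (fun t => P (u t)) a b := by
    have h1 : AbsolutelyContinuousOnInterval (fun x ↦ ∫ v in a..x, u' v) a b :=
      (h.intervalIntegrable a b).absolutelyContinuousOnInterval_intervalIntegral left_mem_uIcc
    apply squeeze_zero (fun t ↦ ?_) (fun t ↦ ?_) (by simpa using Tendsto.const_mul (K:ℝ) h1)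
    · exact Finset.sum_nonneg (fun i hi ↦ by positivity)
    · rw [Finset.mul_sum]
      apply Finset.sum_le_sum
      intro i _
      refine (hP.dist_le_mul _ _).trans ?_
      rw [h.2 a (t.2 i).1, h.2 a (t.2 i).2, dist_add_left]
  have hd := _root_.LocallyIntegrable.ae_hasDerivAt_integral h.locallyIntegrable
  rw [← hac.integral_deriv_eq_sub]
  apply intervalIntegral.integral_congr_ae
  filter_upwards [hd] with t ht _
  have h2 : HasDerivAt u (u' t) t := by
    have h3 : u = fun t => u a + ∫ x in a..t, u' x := by
      funext t; exact h.2 a t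
    rw [h3]
    exact (ht a).const_add _
  exact ((hPp (u t)).comp t h2).deriv.symm

lemma crossing {β β' p : ℝ → ℝ} (h : LocAC β β') (hT : Tendsto β atTop (nhds 1))
    (hB : Tendsto β atBot (nhds 1)) (hpc : Continuous p) (hp0 : ∀ x, 0 ≤ p x)
    (K : NNReal) (hpK : ∀ x, p x ≤ K) (t0 : ℝ) :
    ENNReal.ofReal (4 * ∫ x in (0:ℝ)..(1 - β t0), p x) ≤
      ∫⁻ t, ENNReal.ofReal (2 * p (1 - β t) * |β' t|) := by
  set Q : ℝ → ℝ := fun y => ∫ x in (0:ℝ)..y, p x with hQ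
  have hQd : ∀ y, HasDerivAt Q (p y) y := fun y =>
    intervalIntegral.integral_hasDerivAt_right (hpc.intervalIntegrable _ _)
      (hpc.stronglyMeasurableAtFilter _ _) hpc.continuousAt
  have hQc : Continuous Q := continuous_iff_continuousAt.2 fun y => (hQd y).continuousAt
  have hPd : ∀ y, HasDerivAt (fun y => - Q (1 - y)) (p (1 - y)) y := fun y => by
    have h1 : HasDerivAt (fun y : ℝ => 1 - y) (-1) y := by
      simpa using (hasDerivAt_id y).const_sub 1
    have := ((hQd (1 - y)).comp y h1).neg
    rw [mul_neg_one, neg_neg] at this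
    exact this
  have hPL : LipschitzWith K (fun y => - Q (1 - y)) := by
    apply lipschitzWith_of_nnnorm_deriv_le (fun y => (hPd y).differentiableAt)
    intro y
    rw [(hPd y).deriv, ← NNReal.coe_le_coe, coe_nnnorm, Real.norm_eq_abs, abs_of_nonneg (hp0 _)]
    exact hpK _
  have hch := fun a b => h.chain (p := fun y => p (1 - y)) K hPL hPd a b
  have hβc := h.continuous
  -- integrability
  have hii : ∀ a b, IntervalIntegrable (fun t => p (1 - β t) * β' t) volume a b := fun a b =>
    (h.intervalIntegrable a b).continuousOn_mul (by fun_prop)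
  have key : ∀ a b, a ≤ b → ENNReal.ofReal |Q (1 - β a) - Q (1 - β b)| ≤
      ∫⁻ t in Ioc a b, ENNReal.ofReal (p (1 - β t) * |β' t|) := by
    intro a b hab
    have h1 : |Q (1 - β a) - Q (1 - β b)| ≤ ∫ t in a..b, p (1 - β t) * |β' t| := by
      have := hch a b
      have h2 := intervalIntegral.abs_integral_le_integral_abs (f := fun t => p (1 - β t) * β' t) (μ := volume) hab
      rw [this] at h2
      simp only [abs_mul, abs_of_nonneg (hp0 _)] at h2
      refine le_trans (le_of_eq ?_) h2
      congr 1
      ring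
    refine (ENNReal.ofReal_le_ofReal h1).trans ?_
    rw [intervalIntegral.integral_of_le hab, ofReal_integral_eq_lintegral_ofReal]
    · have := (hii a b).abs
      simp only [abs_mul, abs_of_nonneg (hp0 _)] at this
      exact (intervalIntegrable_iff_integrableOn_Ioc_of_le hab).1 this
    · exact Eventually.of_forall fun t => mul_nonneg (hp0 _) (abs_nonneg _)
  have hQ0 : Q 0 = 0 := by simp [hQ]
  have lim : ∀ l : Filter ℝ, Tendsto β l (nhds 1) →
      Tendsto (fun b => ENNReal.ofReal |Q (1 - β t0) - Q (1 - β b)|) l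
        (nhds (ENNReal.ofReal |Q (1 - β t0)|)) := by
    intro l hl
    have h1 : Tendsto (fun b => Q (1 - β b)) l (nhds 0) := by
      have := (hQc.tendsto 0).comp (show Tendsto (fun b => 1 - β b) l (nhds 0) by
        simpa using hl.const_sub 1)
      rwa [hQ0] at this
    have h2 := ENNReal.tendsto_ofReal ((h1.const_sub (Q (1 - β t0))).abs)
    simpa using h2
  have up : ENNReal.ofReal |Q (1 - β t0)| ≤
      ∫⁻ t in Ioi t0, ENNReal.ofReal (p (1 - β t) * |β' t|) := by
    refine le_of_tendsto (lim _ hT) ?_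
    filter_upwards [eventually_ge_atTop t0] with b hb
    exact (key t0 b hb).trans (lintegral_mono_set Ioc_subset_Ioi_self)
  have dn : ENNReal.ofReal |Q (1 - β t0)| ≤
      ∫⁻ t in Iic t0, ENNReal.ofReal (p (1 - β t) * |β' t|) := by
    refine le_of_tendsto (lim _ hB) ?_
    filter_upwards [eventually_le_atBot t0] with b hb
    rw [abs_sub_comm]
    exact (key b t0 hb).trans (lintegral_mono_set Ioc_subset_Iic_self)
  have hsum := lintegral_add_compl (μ := volume)
    (fun t => ENNReal.ofReal (p (1 - β t) * |β' t|)) (measurableSet_Iic (a := t0))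
  rw [compl_Iic] at hsum
  calc ENNReal.ofReal (4 * Q (1 - β t0)) ≤ ENNReal.ofReal (2 * (|Q (1 - β t0)| + |Q (1 - β t0)|)) := by
        apply ENNReal.ofReal_le_ofReal
        linarith [le_abs_self (Q (1 - β t0))]
    _ = ENNReal.ofReal 2 * (ENNReal.ofReal |Q (1 - β t0)| + ENNReal.ofReal |Q (1 - β t0)|) := by
        rw [ENNReal.ofReal_mul (by norm_num), ENNReal.ofReal_add (abs_nonneg _) (abs_nonneg _)]
    _ ≤ ENNReal.ofReal 2 * ∫⁻ t, ENNReal.ofReal (p (1 - β t) * |β' t|) := by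
        rw [← hsum]
        gcongr
    _ = _ := by
        rw [← lintegral_const_mul' _ _ ENNReal.ofReal_ne_top]
        congr 1
        funext t
        rw [← ENNReal.ofReal_mul (by norm_num), mul_assoc]

lemma sq_le_Gfun {f : ℝ → ℝ≥0∞} {s : ℝ} {α α' β β' : ℝ → ℝ} (h : MemU1 α α' β β') (t0 : ℝ) :
    ENNReal.ofReal ((1 - β t0) ^ 2) ≤ Gfun f s α' β β' := by
  obtain ⟨-, hβ, -, -, h01, hT, hB⟩ := h
  set p : ℝ → ℝ := fun x => max 0 (min x 1) / 2 with hp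
  have hpc : Continuous p := by fun_prop
  have hpe : ∀ x ∈ Icc (0:ℝ) 1, p x = x / 2 := by
    intro x hx
    simp [hp, min_eq_left hx.2, max_eq_right hx.1]
  have hc := crossing hβ hT hB hpc (fun x => by positivity) 1 (fun x => by
    have : max 0 (min x 1) ≤ 1 := max_le (by norm_num) (min_le_right _ _)
    simp only [hp, NNReal.coe_one]; linarith) t0
  have hI : ∫ x in (0:ℝ)..(1 - β t0), p x = (1 - β t0) ^ 2 / 4 := by
    have : ∫ x in (0:ℝ)..(1 - β t0), p x = ∫ x in (0:ℝ)..(1 - β t0), x / 2 := by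
      apply intervalIntegral.integral_congr
      intro x hx
      rw [uIcc_of_le (by linarith [(h01 t0).2])] at hx
      exact hpe x ⟨hx.1, by linarith [hx.2, (h01 t0).1]⟩
    rw [this]
    simp
    ring
  rw [hI] at hc
  refine le_trans (le_of_eq (by congr 1; ring)) (hc.trans ?_)
  apply lintegral_mono
  intro t
  refine le_trans ?_ le_add_self
  apply ENNReal.ofReal_le_ofReal
  rw [hpe _ ⟨by linarith [(h01 t).2], by linarith [(h01 t).1]⟩]
  nlinarith [sq_nonneg ((1 - β t) / 2 - |β' t|), sq_abs (β' t)]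

lemma part2 {f : ℝ → ℝ≥0∞} {s : ℝ} (hlt : g0E f s < 1) {α α' β β' : ℝ → ℝ}
    (h : MemU1 α α' β β') (hG : Gfun f s α' β β' = g0E f s) (t : ℝ) :
    1 - Real.sqrt ((g0E f s).toReal) ≤ β t := by
  have h1 := sq_le_Gfun (f := f) (s := s) h t
  rw [hG] at h1
  have h2 : (1 - β t) ^ 2 ≤ (g0E f s).toReal := by
    rw [← ENNReal.toReal_ofReal (sq_nonneg (1 - β t))]
    exact ENNReal.toReal_mono (ne_top_of_lt hlt) h1
  have := Real.le_sqrt_of_sq_le h2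
  linarith

section Fprops
variable {ℓ ℓ₁ : ℝ} {f : ℝ → ℝ≥0∞} {f₁ : ℝ → ℝ}

lemma FHyp.one_eq (hf : FHyp ℓ ℓ₁ f f₁) : f₁ 1 = 0 := by
  rw [hf.hf₁ 1 ⟨by norm_num, le_refl _⟩]
  simp [(hf.fzero 0 ⟨le_refl _, by norm_num⟩).2 rfl]

lemma FHyp.pos (hf : FHyp ℓ ℓ₁ f f₁) {w : ℝ} (h0 : 0 ≤ w) (h1 : w < 1) : 0 < f₁ w := by
  rw [← hf.one_eq]
  exact hf.f₁anti ⟨h0, h1.le⟩ ⟨by norm_num, le_refl _⟩ h1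

lemma FHyp.nonneg (hf : FHyp ℓ ℓ₁ f f₁) {w : ℝ} (h0 : 0 ≤ w) (h1 : w ≤ 1) : 0 ≤ f₁ w := by
  rw [← hf.one_eq]
  exact hf.f₁anti.antitoneOn ⟨h0, h1⟩ ⟨by norm_num, le_refl _⟩ h1

lemma FHyp.f_eq (hf : FHyp ℓ ℓ₁ f f₁) {w : ℝ} (h0 : 0 < w) (h1 : w ≤ 1) :
    f (1 - w) = ENNReal.ofReal (f₁ w / w) := by
  rw [hf.hf₁ w ⟨h0, h1⟩, mul_div_cancel_left₀ _ h0.ne', ENNReal.ofReal_toReal]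
  exact hf.freal _ ⟨by linarith, by linarith⟩

lemma FHyp.cont (hf : FHyp ℓ ℓ₁ f f₁) : ContinuousOn f₁ (Icc 0 1) := by
  intro x hx
  rcases eq_or_lt_of_le hx.1 with h | h
  · subst h
    have h1 : Tendsto f₁ (nhdsWithin 0 (Ioi 0)) (nhds ℓ) := by
      have h2 : Tendsto (fun s : ℝ => s) (nhdsWithin 0 (Ioi 0)) (nhds 0) :=
        tendsto_id.mono_left nhdsWithin_le_nhds
      have h3 := ((hf.lim0.mul h2).add_const ℓ).sub (h2.const_mul ℓ₁)
      simp only [mul_zero, zero_add, sub_zero] at h3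
      refine h3.congr' ?_
      filter_upwards [self_mem_nhdsWithin] with s hs
      have : s ≠ 0 := ne_of_gt hs
      field_simp
      ring
    have h4 : ContinuousWithinAt f₁ (Ici 0) 0 := by
      rw [← continuousWithinAt_Ioi_iff_Ici]
      show Tendsto _ _ _
      rw [hf.hf₁0]; exact h1
    exact h4.mono Icc_subset_Ici_self
  · obtain ⟨d, -, hd⟩ := hf.fdiff
    have h1 : ContinuousWithinAt (fun s => s * (f (1 - s)).toReal) (Ioc 0 1) x := by
      refine continuousWithinAt_id.mul ?_
      have h2 := (hd (1 - x) ⟨by linarith [hx.2], by linarith⟩).continuousWithinAt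
      exact h2.comp (f := fun s : ℝ => 1 - s) (by fun_prop : Continuous fun s : ℝ => 1 - s).continuousWithinAt
        (fun s hs => ⟨by linarith [hs.2], by linarith [hs.1]⟩)
    have h3 : ContinuousWithinAt f₁ (Ioc 0 1) x :=
      h1.congr (fun y hy => hf.hf₁ y hy) (hf.hf₁ x ⟨h, hx.2⟩)
    refine h3.mono_of_mem_nhdsWithin ?_
    filter_upwards [self_mem_nhdsWithin, mem_nhdsWithin_of_mem_nhds (Ioi_mem_nhds h)] with y hy hy2
    exact ⟨hy2, hy.2⟩

/-- phase-plane speed -/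
noncomputable def pp (f₁ : ℝ → ℝ) (M w : ℝ) : ℝ := w / 2 * Real.sqrt (1 - (f₁ M / f₁ w) ^ 2)

noncomputable def Phi (f₁ : ℝ → ℝ) (s M : ℝ) : ℝ := s * f₁ M + 4 * ∫ w in Ioo (0:ℝ) 1, pp f₁ M w

lemma pp_nonneg {M w : ℝ} (h0 : 0 ≤ w) : 0 ≤ pp f₁ M w := by unfold pp; positivity

lemma pp_le {M w : ℝ} (h0 : 0 ≤ w) : pp f₁ M w ≤ w / 2 := by
  unfold pp
  have : Real.sqrt (1 - (f₁ M / f₁ w) ^ 2) ≤ 1 := by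
    rw [Real.sqrt_le_one]
    nlinarith [sq_nonneg (f₁ M / f₁ w)]
  nlinarith

lemma FHyp.pp_zero_of_le (hf : FHyp ℓ ℓ₁ f f₁) {M w : ℝ} (h0 : 0 ≤ M) (hMw : M ≤ w) (hw : w < 1) :
    pp f₁ M w = 0 := by
  have h1 := hf.f₁anti.antitoneOn ⟨h0, by linarith⟩ ⟨by linarith, hw.le⟩ hMw
  have h2 := hf.pos (by linarith : 0 ≤ w) hw
  unfold pp
  rw [Real.sqrt_eq_zero_of_nonpos, mul_zero]
  have : 1 ≤ f₁ M / f₁ w := by rwa [one_le_div h2]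
  nlinarith

lemma FHyp.ratio_lt (hf : FHyp ℓ ℓ₁ f f₁) {M w : ℝ} (h0 : 0 ≤ w) (hMw : w < M) (hM : M ≤ 1) :
    0 < 1 - (f₁ M / f₁ w) ^ 2 := by
  have h1 := hf.f₁anti ⟨h0, by linarith⟩ ⟨by linarith, hM⟩ hMw
  have h2 := hf.pos h0 (by linarith)
  have h3 := hf.nonneg (by linarith : 0 ≤ M) hM
  have : f₁ M / f₁ w < 1 := by rwa [div_lt_one h2]
  have h4 : 0 ≤ f₁ M / f₁ w := by positivity
  nlinarith

lemma FHyp.ratio_le (hf : FHyp ℓ ℓ₁ f f₁) {M w : ℝ} (h0 : 0 ≤ w) (hMw : w ≤ M) (hM : M < 1) :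
    0 ≤ 1 - (f₁ M / f₁ w) ^ 2 := by
  rcases eq_or_lt_of_le hMw with h | h
  · subst h
    rw [div_self (hf.pos h0 hM).ne']; norm_num
  · exact (hf.ratio_lt h0 h hM.le).le

lemma FHyp.pp_sq (hf : FHyp ℓ ℓ₁ f f₁) {M w : ℝ} (h0 : 0 ≤ w) (hMw : w ≤ M) (hM : M < 1) :
    pp f₁ M w ^ 2 = w ^ 2 / 4 - (f₁ M / 2) ^ 2 * (w / f₁ w) ^ 2 := by
  unfold pp
  rw [mul_pow, Real.sq_sqrt (hf.ratio_le h0 hMw hM)]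
  ring

lemma FHyp.pp_pos (hf : FHyp ℓ ℓ₁ f f₁) {M w : ℝ} (h0 : 0 < w) (hMw : w < M) (hM : M ≤ 1) :
    0 < pp f₁ M w := by
  unfold pp
  have := Real.sqrt_pos.2 (hf.ratio_lt h0.le hMw hM)
  positivity

lemma FHyp.pp_contOn (hf : FHyp ℓ ℓ₁ f f₁) (M : ℝ) : ContinuousOn (pp f₁ M) (Ico 0 1) := by
  unfold pp
  have h1 : ContinuousOn f₁ (Ico 0 1) := hf.cont.mono Ico_subset_Icc_self
  have h2 : ContinuousOn (fun w => f₁ M / f₁ w) (Ico 0 1) :=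
    continuousOn_const.div h1 (fun w hw => (hf.pos hw.1 hw.2).ne')
  fun_prop

lemma FHyp.pp_integrable (hf : FHyp ℓ ℓ₁ f f₁) (M : ℝ) : IntegrableOn (pp f₁ M) (Ioo 0 1) := by
  refine Integrable.of_bound (C := 1)
    (((hf.pp_contOn M).mono Ioo_subset_Ico_self).aestronglyMeasurable measurableSet_Ioo) ?_
  filter_upwards [ae_restrict_mem measurableSet_Ioo] with w hw
  rw [Real.norm_eq_abs, abs_of_nonneg (pp_nonneg hw.1.le)]
  linarith [pp_le (f₁ := f₁) (M := M) hw.1.le, hw.2]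

lemma FHyp.Phi_cont (hf : FHyp ℓ ℓ₁ f f₁) (s : ℝ) : ContinuousOn (Phi f₁ s) (Icc 0 1) := by
  unfold Phi
  refine (continuousOn_const.mul hf.cont).add (continuousOn_const.mul ?_)
  intro M hM
  refine tendsto_integral_filter_of_dominated_convergence (fun _ => 1) ?_ ?_ ?_ ?_
  · exact Eventually.of_forall fun M' => (hf.pp_integrable M').aestronglyMeasurable
  · refine Eventually.of_forall fun M' => ?_
    filter_upwards [ae_restrict_mem measurableSet_Ioo] with w hw
    rw [Real.norm_eq_abs, abs_of_nonneg (pp_nonneg hw.1.le)]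
    linarith [pp_le (f₁ := f₁) (M := M') hw.1.le, hw.2]
  · simp
  · refine Eventually.of_forall fun w => ?_
    unfold pp
    have h := hf.cont M hM
    have : ContinuousWithinAt (fun M => w / 2 * Real.sqrt (1 - (f₁ M / f₁ w) ^ 2)) (Icc 0 1) M := by
      have h2 : ContinuousWithinAt (fun M => f₁ M / f₁ w) (Icc 0 1) M := h.div_const _
      fun_prop
    exact this

/-- The integral of `pp` only sees `[0,M]`. -/
lemma FHyp.integral_pp (hf : FHyp ℓ ℓ₁ f f₁) {M M' : ℝ} (h0 : 0 ≤ M) (hMM' : M ≤ M') (h1 : M' < 1) :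
    ∫ w in Ioo (0:ℝ) 1, pp f₁ M w = ∫ w in (0:ℝ)..M', pp f₁ M w := by
  rw [intervalIntegral.integral_of_le (by linarith)]
  apply setIntegral_eq_of_subset_of_forall_sdiff_eq_zero measurableSet_Ioo
  · intro x hx; exact ⟨hx.1, by linarith [hx.2]⟩
  · intro x hx
    apply hf.pp_zero_of_le h0 _ hx.1.2
    by_contra hc
    exact hx.2 ⟨hx.1.1, by linarith⟩

lemma FHyp.Phi_zero (hf : FHyp ℓ ℓ₁ f f₁) (s : ℝ) : Phi f₁ s 0 = s * ℓ := by
  unfold Phi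
  rw [hf.hf₁0, setIntegral_congr_fun (g := fun _ => 0) measurableSet_Ioo]
  · simp
  · intro w hw
    exact hf.pp_zero_of_le le_rfl hw.1.le hw.2

lemma FHyp.Phi_one (hf : FHyp ℓ ℓ₁ f f₁) (s : ℝ) : Phi f₁ s 1 = 1 := by
  unfold Phi pp
  rw [hf.one_eq]
  simp only [zero_div, ne_eq, OfNat.ofNat_ne_zero, not_false_eq_true, zero_pow, sub_zero,
    Real.sqrt_one, mul_one, mul_zero, zero_add]
  rw [← integral_Ioc_eq_integral_Ioo, ← intervalIntegral.integral_of_le (by norm_num)]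
  simp
  norm_num

lemma FHyp.Phi_small (hf : FHyp ℓ ℓ₁ f f₁) {s : ℝ} (hs : 0 < s) :
    ∃ M ∈ Ioo (0:ℝ) 1, Phi f₁ s M < s * ℓ := by
  have hl := hf.hl1
  have h1 := hf.lim0.eventually (gt_mem_nhds (show (0:ℝ) < ℓ₁ / 2 by positivity))
  have h2 : ∀ᶠ M : ℝ in nhdsWithin 0 (Ioi 0), M ∈ Ioo (0:ℝ) (min 1 (s * ℓ₁ / 2)) :=
    Ioo_mem_nhdsGT (by positivity)
  obtain ⟨M, hM1, hM2, hM3⟩ := (h1.and h2).exists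
  have hMlt : M < 1 := hM3.trans_le (min_le_left _ _)
  have hMs : M < s * ℓ₁ / 2 := hM3.trans_le (min_le_right _ _)
  refine ⟨M, ⟨hM2, hMlt⟩, ?_⟩
  have h3 : f₁ M - ℓ + ℓ₁ * M < ℓ₁ / 2 * M := by rwa [div_lt_iff₀ hM2] at hM1
  have h4 : ∫ w in Ioo (0:ℝ) 1, pp f₁ M w ≤ M ^ 2 / 4 := by
    rw [hf.integral_pp hM2.le le_rfl hMlt]
    have : ∫ w in (0:ℝ)..M, w / 2 = M ^ 2 / 4 := by
      simp; ring
    rw [← this]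
    apply intervalIntegral.integral_mono_on hM2.le
    · apply ContinuousOn.intervalIntegrable
      rw [uIcc_of_le hM2.le]
      exact (hf.pp_contOn M).mono fun x hx => ⟨hx.1, by linarith [hx.2]⟩
    · exact (by fun_prop : Continuous fun w : ℝ => w / 2).intervalIntegrable _ _
    · intro x hx
      exact pp_le hx.1
  unfold Phi
  have h5 : s * f₁ M < s * (ℓ - ℓ₁ / 2 * M) := by
    apply mul_lt_mul_of_pos_left _ hs; linarith
  nlinarith

lemma FHyp.exists_min (hf : FHyp ℓ ℓ₁ f f₁) {s : ℝ} (hs : 0 < s)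
    (h1 : ∃ M ∈ Ioo (0:ℝ) 1, Phi f₁ s M < 1) :
    ∃ M ∈ Ioo (0:ℝ) 1, ∀ M' ∈ Ioo (0:ℝ) 1, Phi f₁ s M ≤ Phi f₁ s M' := by
  obtain ⟨M, hM, hmin⟩ := isCompact_Icc.exists_isMinOn (nonempty_Icc.2 zero_le_one) (hf.Phi_cont s)
  obtain ⟨M1, hM1, hlt1⟩ := h1
  obtain ⟨M2, hM2, hlt2⟩ := hf.Phi_small hs
  refine ⟨M, ⟨lt_of_le_of_ne hM.1 ?_, lt_of_le_of_ne hM.2 ?_⟩, fun M' hM' => hmin (Ioo_subset_Icc_self hM')⟩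
  · rintro rfl
    have := hmin (Ioo_subset_Icc_self hM2)
    simp only [mem_ofPred_eq, hf.Phi_zero] at this
    linarith
  · rintro rfl
    have := hmin (Ioo_subset_Icc_self hM1)
    simp only [mem_ofPred_eq, hf.Phi_one] at this
    linarith

end Fprops

section Lower
variable {ℓ ℓ₁ : ℝ} {f : ℝ → ℝ≥0∞} {f₁ : ℝ → ℝ}

lemma abs_int_bound {α' : ℝ → ℝ} (hi : Integrable α') (h1 : |∫ t : ℝ, α' t| = 1) {c : ℝ} (hc : 0 ≤ c) :
    ENNReal.ofReal c ≤ ∫⁻ t, ENNReal.ofReal (c * |α' t|) := by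
  rw [← ofReal_integral_eq_lintegral_ofReal (hi.abs.const_mul c)
    (Eventually.of_forall fun t => by positivity)]
  apply ENNReal.ofReal_le_ofReal
  rw [integral_const_mul]
  have := abs_integral_le_integral_abs (f := α') (μ := volume)
  rw [h1] at this
  nlinarith

lemma FHyp.lower (hf : FHyp ℓ ℓ₁ f f₁) {s : ℝ} (hs : 0 < s) {α α' β β' : ℝ → ℝ}
    (h : MemU1 α α' β β') (hG : Gfun f s α' β β' < 1) :
    ∃ M ∈ Ioo (0:ℝ) 1, ENNReal.ofReal (Phi f₁ s M) ≤ Gfun f s α' β β' := by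
  have hsq := fun t => sq_le_Gfun (f := f) (s := s) h t
  obtain ⟨-, hβ, hαi, hα1, h01, hT, hB⟩ := h
  -- nontrivial
  have hne : ∃ t1, 0 < 1 - β t1 := by
    by_contra hcon
    push Not at hcon
    have hβ1 : ∀ t, β t = 1 := fun t => le_antisymm (h01 t).2 (by linarith [hcon t])
    have h1 : ENNReal.ofReal 1 ≤ Gfun f s α' β β' := by
      refine (abs_int_bound hαi hα1 zero_le_one).trans ?_
      apply lintegral_mono
      intro t
      refine le_trans ?_ le_self_add
      rw [hβ1 t, hf.ftop]
      by_cases ha : α' t = 0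
      · simp [ha]
      · have : 0 < s ^ 2 * (α' t) ^ 2 := by positivity
        rw [ENNReal.top_pow (by norm_num), ENNReal.mul_top (by simpa using this)]
        exact le_top
    rw [ENNReal.ofReal_one] at h1
    exact absurd hG (not_lt.2 h1)
  obtain ⟨t1, ht1⟩ := hne
  have hβc := hβ.continuous
  obtain ⟨t0, ht0⟩ : ∃ t0, ∀ t, 1 - β t ≤ 1 - β t0 := by
    apply (by fun_prop : Continuous fun t => 1 - β t).exists_forall_ge' t1
    rw [cocompact_eq_atBot_atTop]
    have key : ∀ l : Filter ℝ, Tendsto β l (nhds 1) → ∀ᶠ t in l, 1 - β t ≤ 1 - β t1 := by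
      intro l hl
      filter_upwards [hl.eventually (lt_mem_nhds (show β t1 < 1 by linarith))] with t ht
      linarith
    exact eventually_sup.2 ⟨key _ hB, key _ hT⟩
  set M := 1 - β t0 with hMdef
  have hM0 : 0 < M := ht1.trans_le (ht0 t1)
  have hM1 : M < 1 := by
    have h2 : M ^ 2 < 1 := by
      have := (hsq t0).trans_lt hG
      rwa [ENNReal.ofReal_lt_one] at this
    nlinarith
  refine ⟨M, ⟨hM0, hM1⟩, ?_⟩
  have hfM := hf.pos hM0.le hM1
  set p : ℝ → ℝ := fun x => pp f₁ M (max 0 (min x M)) with hp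
  have hmem : ∀ x, max 0 (min x M) ∈ Icc 0 M := fun x =>
    ⟨le_max_left _ _, max_le hM0.le (min_le_right _ _)⟩
  have hpc : Continuous p :=
    (hf.pp_contOn M).comp_continuous (by fun_prop) (fun x => ⟨(hmem x).1, (hmem x).2.trans_lt hM1⟩)
  have hpe : ∀ x ∈ Icc (0:ℝ) M, p x = pp f₁ M x := by
    intro x hx
    simp [hp, min_eq_left hx.2, max_eq_right hx.1]
  have hc := crossing hβ hT hB hpc (fun x => pp_nonneg (hmem x).1) 1 (fun x => by
    have h1 := pp_le (f₁ := f₁) (M := M) (hmem x).1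
    have h2 := (hmem x).2
    simp only [hp, NNReal.coe_one]; linarith) t0
  have hI : ∫ x in (0:ℝ)..M, p x = ∫ w in Ioo (0:ℝ) 1, pp f₁ M w := by
    rw [hf.integral_pp hM0.le le_rfl hM1]
    apply intervalIntegral.integral_congr
    intro x hx
    rw [uIcc_of_le hM0.le] at hx
    exact hpe x hx
  rw [← hMdef, hI] at hc
  have ha := abs_int_bound hαi hα1 (c := s * f₁ M) (by positivity)
  unfold Phi
  refine ENNReal.ofReal_add_le.trans ((add_le_add ha hc).trans ?_)
  refine (le_lintegral_add _ _).trans ?_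
  apply lintegral_mono
  intro t
  have hw0 : 0 ≤ 1 - β t := by linarith [(h01 t).2]
  have hwM := ht0 t
  simp only
  rw [hpe _ ⟨hw0, hwM⟩]
  rcases eq_or_lt_of_le hw0 with hw | hw
  · have hβ1 : β t = 1 := by linarith
    have hz : pp f₁ M (1 - β t) = 0 := by rw [← hw]; simp [pp]
    rw [hz, hβ1, hf.ftop]
    by_cases ha : α' t = 0
    · simp [ha]
    · have : 0 < s ^ 2 * (α' t) ^ 2 := by positivity
      rw [ENNReal.top_pow (by norm_num), ENNReal.mul_top (by simpa using this)]
      simp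
  · have hfe : f (β t) = ENNReal.ofReal (f₁ (1 - β t) / (1 - β t)) := by
      rw [← hf.f_eq hw (by linarith)]; congr 1; ring
    have hfw := hf.pos hw0 (by linarith)
    have hpsq := hf.pp_sq hw0 hwM hM1
    have hp0 := pp_nonneg (f₁ := f₁) (M := M) hw0
    rw [hfe, ← ENNReal.ofReal_pow (by positivity), ← ENNReal.ofReal_mul (by positivity),
      ← ENNReal.ofReal_add (by positivity) (by positivity),
      ← ENNReal.ofReal_add (by positivity) (by positivity)]
    apply ENNReal.ofReal_le_ofReal
    set w := 1 - β t
    have e1 : s ^ 2 * α' t ^ 2 * (f₁ w / w) ^ 2 + (f₁ M / 2) ^ 2 * (w / f₁ w) ^ 2 ≥ s * f₁ M * |α' t| := by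
      have e2 : f₁ w / w * (w / f₁ w) = 1 := by field_simp
      have e3 : s * f₁ M * |α' t| = 2 * (s * |α' t| * (f₁ w / w)) * (f₁ M / 2 * (w / f₁ w)) := by
        linear_combination (- s * f₁ M * |α' t|) * e2
      rw [e3, ← sq_abs (α' t)]
      nlinarith [sq_nonneg (s * |α' t| * (f₁ w / w) - f₁ M / 2 * (w / f₁ w))]
    nlinarith [sq_nonneg (pp f₁ M w - |β' t|), sq_abs (β' t)]

/-- At a minimum of `Phi` the profile is not too long. -/
lemma FHyp.Kbound (hf : FHyp ℓ ℓ₁ f f₁) {s M : ℝ} (hM : M ∈ Ioo (0:ℝ) 1)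
    (hmin : ∀ M' ∈ Ioo (0:ℝ) 1, Phi f₁ s M ≤ Phi f₁ s M') {M' : ℝ} (hM' : M' ∈ Ioo 0 M) {ε : ℝ}
    (hε : ε ∈ Ioo 0 M') :
    ∫ w in ε..M', (w / f₁ w) ^ 2 / pp f₁ M w ≤ s / f₁ M := by
  have hM'1 : M' < 1 := hM'.2.trans hM.2
  have hfM := hf.pos hM.1.le hM.2
  have hdel := hf.f₁anti ⟨hM'.1.le, hM'1.le⟩ ⟨hM.1.le, hM.2.le⟩ hM'.2
  have h1 := hmin M' ⟨hM'.1, hM'1⟩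
  unfold Phi at h1
  rw [hf.integral_pp hM'.1.le le_rfl hM'1, hf.integral_pp hM.1.le le_rfl hM.2] at h1
  have hii : ∀ N a b : ℝ, 0 ≤ a → a ≤ b → b < 1 → IntervalIntegrable (pp f₁ N) volume a b := by
    intro N a b h0 hab hb
    apply ContinuousOn.intervalIntegrable
    rw [uIcc_of_le hab]
    exact (hf.pp_contOn N).mono fun x hx => ⟨by linarith [hx.1], by linarith [hx.2]⟩
  have hsplit : ∫ w in (0:ℝ)..M', pp f₁ M w ≤ ∫ w in (0:ℝ)..M, pp f₁ M w := by
    rw [← intervalIntegral.integral_add_adjacent_intervals (hii M 0 M' le_rfl hM'.1.le hM'1)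
      (hii M M' M hM'.1.le hM'.2.le hM.2)]
    have : 0 ≤ ∫ w in M'..M, pp f₁ M w :=
      intervalIntegral.integral_nonneg hM'.2.le fun x hx => pp_nonneg (by linarith [hx.1, hM'.1])
    linarith
  have hmono : ∀ w ∈ Icc 0 M', pp f₁ M' w ≤ pp f₁ M w := by
    intro w hw
    have e1 := hf.pp_sq hw.1 hw.2 hM'1
    have e2 := hf.pp_sq hw.1 (hw.2.trans hM'.2.le) hM.2
    have e3 := pp_nonneg (f₁ := f₁) (M := M) hw.1
    rw [← sq_le_sq₀ (pp_nonneg hw.1) e3]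
    rw [e1, e2]
    have : (f₁ M / 2) ^ 2 ≤ (f₁ M' / 2) ^ 2 := by gcongr
    nlinarith [sq_nonneg (w / f₁ w)]
  have hsplit2 : ∫ w in ε..M', (pp f₁ M w - pp f₁ M' w) ≤ ∫ w in (0:ℝ)..M', (pp f₁ M w - pp f₁ M' w) := by
    rw [← intervalIntegral.integral_add_adjacent_intervals (a := 0) (b := ε) (c := M')
      ((hii M 0 ε le_rfl hε.1.le (hε.2.trans hM'1)).sub (hii M' 0 ε le_rfl hε.1.le (hε.2.trans hM'1)))
      ((hii M ε M' hε.1.le hε.2.le hM'1).sub (hii M' ε M' hε.1.le hε.2.le hM'1))]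
    have : 0 ≤ ∫ w in (0:ℝ)..ε, (pp f₁ M w - pp f₁ M' w) :=
      intervalIntegral.integral_nonneg hε.1.le fun x hx => by
        linarith [hmono x ⟨hx.1, hx.2.trans hε.2.le⟩]
    linarith
  have hcq : IntervalIntegrable (fun w => (w / f₁ w) ^ 2 / pp f₁ M w) volume ε M' := by
    apply ContinuousOn.intervalIntegrable
    rw [uIcc_of_le hε.2.le]
    have hc1 : ContinuousOn f₁ (Icc ε M') :=
      hf.cont.mono (Icc_subset_Icc hε.1.le hM'1.le)
    have hc2 : ContinuousOn (pp f₁ M) (Icc ε M') :=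
      (hf.pp_contOn M).mono fun x hx => ⟨by linarith [hx.1, hε.1], by linarith [hx.2]⟩
    refine ((continuousOn_id.div hc1 fun x hx => ?_).pow 2).div hc2 fun x hx => ?_
    · exact (hf.pos (by linarith [hx.1, hε.1]) (by linarith [hx.2])).ne'
    · exact (hf.pp_pos (by linarith [hx.1, hε.1]) (by linarith [hx.2, hM'.2]) hM.2.le).ne'
  have hpt : ∀ w ∈ Icc ε M', (f₁ M' - f₁ M) * f₁ M / 4 * ((w / f₁ w) ^ 2 / pp f₁ M w)
      ≤ pp f₁ M w - pp f₁ M' w := by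
    intro w hw
    have hw0 : 0 < w := by linarith [hw.1, hε.1]
    have e1 := hf.pp_sq hw0.le hw.2 hM'1
    have e2 := hf.pp_sq hw0.le (hw.2.trans hM'.2.le) hM.2
    have e3 := hf.pp_pos hw0 (hw.2.trans_lt hM'.2) hM.2.le
    have e4 := hmono w ⟨hw0.le, hw.2⟩
    have e5 := pp_nonneg (f₁ := f₁) (M := M') hw0.le
    rw [mul_div_assoc', div_le_iff₀ e3]
    have e6 : (pp f₁ M w - pp f₁ M' w) * (2 * pp f₁ M w) ≥ pp f₁ M w ^ 2 - pp f₁ M' w ^ 2 := by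
      nlinarith
    rw [e1, e2] at e6
    have e7 : (f₁ M' / 2) ^ 2 - (f₁ M / 2) ^ 2 ≥ (f₁ M' - f₁ M) * f₁ M / 2 := by nlinarith
    have e8 := mul_le_mul_of_nonneg_right e7 (sq_nonneg (w / f₁ w))
    linarith
  have hKI := intervalIntegral.integral_mono_on hε.2.le (hcq.const_mul _)
    ((hii M ε M' hε.1.le hε.2.le hM'1).sub (hii M' ε M' hε.1.le hε.2.le hM'1)) hpt
  rw [intervalIntegral.integral_const_mul] at hKI
  rw [intervalIntegral.integral_sub (hii M 0 M' le_rfl hM'.1.le hM'1)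
    (hii M' 0 M' le_rfl hM'.1.le hM'1)] at hsplit2
  rw [le_div_iff₀ hfM]
  have hfin : (f₁ M' - f₁ M) * ((∫ w in ε..M', (w / f₁ w) ^ 2 / pp f₁ M w) * f₁ M) ≤ (f₁ M' - f₁ M) * s := by
    linarith
  exact le_of_mul_le_mul_left hfin (by linarith)

end Lower

lemma profile {M : ℝ} (hM : 0 < M) (hM1 : M < 1) {p : ℝ → ℝ} (hpc : ContinuousOn p (Icc 0 M))
    (hpos : ∀ x ∈ Ioo 0 M, 0 < p x) (hple : ∀ x ∈ Icc 0 M, p x ≤ x)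
    (hInt : ∀ c ∈ Ioo 0 M, IntegrableOn (fun x => 1 / p x) (Icc c M)) :
    ∃ w : ℝ → ℝ, Continuous w ∧ (∀ t ≤ 0, w t = M) ∧ (∀ t, 0 < w t ∧ w t ≤ M) ∧
      (∀ t > 0, w t < M) ∧ (∀ t > 0, HasDerivAt w (- p (w t)) t) ∧ Tendsto w atTop (nhds 0) := by
  set T : ℝ → ℝ := fun x => ∫ r in x..M, 1 / p r with hT
  have hii : ∀ x y, 0 < x → x ≤ y → y ≤ M → IntervalIntegrable (fun x => 1 / p x) volume x y := by
    intro x y hx hxy hy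
    rcases eq_or_lt_of_le (hxy.trans hy) with h | h
    · have : y = x := by linarith
      subst this; exact IntervalIntegrable.refl
    · rw [intervalIntegrable_iff_integrableOn_Icc_of_le hxy]
      exact (hInt x ⟨hx, h⟩).mono_set (Icc_subset_Icc le_rfl hy)
  have hTM : T M = 0 := by simp [hT]
  have hlog : ∀ x y, 0 < x → x ≤ y → y ≤ M → Real.log (y / x) ≤ T x - T y := by
    intro x y hx hxy hy
    have h1 : T x - T y = ∫ r in x..y, 1 / p r := by
      simp only [hT]
      rw [← intervalIntegral.integral_add_adjacent_intervals (hii x y hx hxy hy)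
        (hii y M (hx.trans_le hxy) hy le_rfl)]
      ring
    rw [h1, ← integral_one_div_of_pos hx (hx.trans_le hxy)]
    apply intervalIntegral.integral_mono_on_of_le_Ioo hxy
    · apply ContinuousOn.intervalIntegrable
      rw [uIcc_of_le hxy]
      exact continuousOn_const.div continuousOn_id fun z hz => ne_of_gt (hx.trans_le hz.1)
    · exact hii x y hx hxy hy
    · intro z hz
      have hz0 : 0 < z := hx.trans hz.1
      have hzM : z < M := hz.2.trans_le hy
      exact one_div_le_one_div_of_le (hpos z ⟨hz0, hzM⟩) (hple z ⟨hz0.le, hzM.le⟩)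
  have hexp : ∀ x y, 0 < x → x ≤ y → y ≤ M → y - x ≤ T x - T y := by
    intro x y hx hxy hy
    refine le_trans ?_ (hlog x y hx hxy hy)
    have hy0 : 0 < y := hx.trans_le hxy
    have h1 := Real.one_sub_inv_le_log_of_pos (show 0 < y / x by positivity)
    refine le_trans ?_ h1
    rw [inv_div]
    have : 1 - x / y = (y - x) / y := by field_simp
    rw [this, le_div_iff₀ hy0]
    nlinarith
  have hTc : ∀ c ∈ Ioo 0 M, ContinuousOn T (Icc c M) := by
    intro c hc
    have := intervalIntegral.continuousOn_primitive_interval_left (μ := volume)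
      (f := fun x => 1 / p x) (a := c) (b := M) (by
        rw [uIcc_of_le hc.2.le]; exact hInt c hc)
    rwa [uIcc_of_le hc.2.le] at this
  have hex : ∀ t, 0 ≤ t → ∃ x, (0 < x ∧ x ≤ M) ∧ T x = t := by
    intro t ht
    have he : Real.exp (-t) ≤ 1 := by rw [Real.exp_le_one_iff]; linarith
    have he0 := Real.exp_pos (-t)
    set c := M * Real.exp (-t) / 2 with hc
    have hc0 : 0 < c := by positivity
    have hcM : c < M := by nlinarith
    have h1 := intermediate_value_Icc' hcM.le (hTc c ⟨hc0, hcM⟩)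
    have h2 : t ≤ T c := by
      have h3 := hlog c M hc0 hcM.le le_rfl
      rw [hTM, sub_zero] at h3
      refine le_trans ?_ h3
      rw [Real.le_log_iff_exp_le (by positivity), le_div_iff₀ hc0, hc]
      have : Real.exp t * Real.exp (-t) = 1 := by rw [← Real.exp_add]; simp
      nlinarith
    obtain ⟨x, hx, hxt⟩ := h1 ⟨by rw [hTM]; exact ht, h2⟩
    exact ⟨x, ⟨hc0.trans_le hx.1, hx.2⟩, hxt⟩
  choose w0 hw0 hw0T using hex
  set w : ℝ → ℝ := fun t => w0 (max t 0) (le_max_right _ _) with hw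
  have hwm : ∀ t, 0 < w t ∧ w t ≤ M := fun t => hw0 _ _
  have hwT : ∀ t, T (w t) = max t 0 := fun t => hw0T _ _
  have hLip : ∀ a b, |w a - w b| ≤ |a - b| := by
    intro a b
    have h1 : |w a - w b| ≤ |T (w a) - T (w b)| := by
      rcases le_total (w a) (w b) with h | h
      · have := hexp _ _ (hwm a).1 h (hwm b).2
        rw [abs_of_nonpos (by linarith)]
        exact le_trans (by linarith) (le_abs_self _)
      · have := hexp _ _ (hwm b).1 h (hwm a).2
        rw [abs_of_nonneg (by linarith), abs_sub_comm]
        exact le_trans (by linarith) (le_abs_self _)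
    rw [hwT, hwT] at h1
    exact h1.trans (abs_max_sub_max_le_abs _ _ _)
  have hwc : Continuous w := by
    have : LipschitzWith 1 w := LipschitzWith.of_dist_le_mul fun a b => by
      simp only [Real.dist_eq, NNReal.coe_one, one_mul]; exact hLip a b
    exact this.continuous
  have hinj : ∀ x, 0 < x → x ≤ M → T x = 0 → x = M := by
    intro x h0 h1 h2
    have := hexp x M h0 h1 le_rfl
    rw [hTM, h2] at this; linarith
  refine ⟨w, hwc, ?_, hwm, ?_, ?_, ?_⟩
  · intro t ht
    apply hinj _ (hwm t).1 (hwm t).2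
    rw [hwT, max_eq_right ht]
  · intro t ht
    refine lt_of_le_of_ne (hwm t).2 fun h => ?_
    have := hwT t
    rw [h, hTM, max_eq_left (le_of_lt ht)] at this
    linarith
  · intro t ht
    have hlt : w t < M := by
      refine lt_of_le_of_ne (hwm t).2 fun h => ?_
      have := hwT t
      rw [h, hTM, max_eq_left (le_of_lt ht)] at this
      linarith
    have hpw := hpos (w t) ⟨(hwm t).1, hlt⟩
    have hca : ContinuousOn (fun x => 1 / p x) (Ioo 0 M) :=
      continuousOn_const.div (hpc.mono Ioo_subset_Icc_self) fun x hx => (hpos x hx).ne'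
    have hTd : HasDerivAt T (-(1 / p (w t))) (w t) := by
      apply intervalIntegral.integral_hasDerivAt_left (hii _ _ (hwm t).1 hlt.le le_rfl)
      · exact ContinuousOn.stronglyMeasurableAtFilter isOpen_Ioo hca _ ⟨(hwm t).1, hlt⟩
      · exact hca.continuousAt (Ioo_mem_nhds (hwm t).1 hlt)
    have := HasDerivAt.of_local_left_inverse (hwc.continuousAt (x := t)) hTd (by
      have : (1 / p (w t)) ≠ 0 := by positivity
      simpa using this) (by
      filter_upwards [Ioi_mem_nhds ht] with y hy
      rw [hwT, max_eq_left (le_of_lt hy)])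
    rw [inv_neg, one_div, inv_inv] at this
    exact this
  · rw [Metric.tendsto_atTop]
    intro ε hε
    set c := min ε (M / 2) with hc
    have hc0 : 0 < c := by positivity
    have hcM : c ≤ M := (min_le_right _ _).trans (by linarith)
    refine ⟨max 0 (T c + 1), fun t ht => ?_⟩
    have ht0 : 0 ≤ t := (le_max_left _ _).trans ht
    have ht1 : T c + 1 ≤ t := (le_max_right _ _).trans ht
    rw [Real.dist_eq, sub_zero, abs_of_pos (hwm t).1]
    refine lt_of_lt_of_le ?_ (min_le_left ε (M / 2))
    rw [← hc]
    by_contra hcon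
    push Not at hcon
    have h2 := hexp c (w t) hc0 hcon (hwm t).2
    rw [hwT, max_eq_left ht0] at h2
    linarith

lemma bdd_integrable {M K : ℝ} (hM : 0 < M) {q : ℝ → ℝ} (hqc : ContinuousOn q (Ioo 0 M))
    (hq0 : ∀ x ∈ Ioo 0 M, 0 ≤ q x)
    (hK : ∀ b ∈ Ioo 0 M, ∀ a ∈ Ioo 0 b, ∫ x in a..b, q x ≤ K) :
    IntegrableOn q (Ioc 0 M) ∧ ∫ x in (0:ℝ)..M, q x ≤ K := by
  set a : ℕ → ℝ := fun n => M / ((n:ℝ) + 3) with ha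
  have hapos : ∀ n, 0 < a n := fun n => by simp only [ha]; positivity
  have hale : ∀ n, a n ≤ M / 3 := fun n => by
    simp only [ha]
    apply div_le_div_of_nonneg_left hM.le (by norm_num)
    have : (0:ℝ) ≤ n := Nat.cast_nonneg n
    linarith
  have hat : Tendsto a atTop (nhds 0) := by
    apply Tendsto.div_atTop tendsto_const_nhds
    exact tendsto_atTop_add_const_right _ _ tendsto_natCast_atTop_atTop
  have hbt : Tendsto (fun n => M - a n) atTop (nhds M) := by
    simpa using (tendsto_const_nhds (x := M)).sub hat
  have hsub : ∀ n, Icc (a n) (M - a n) ⊆ Ioo 0 M := fun n x hx =>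
    ⟨(hapos n).trans_le hx.1, by linarith [hx.2, hapos n]⟩
  have hlt : ∀ n, a n < M - a n := fun n => by linarith [hale n]
  have hb : ∀ n, ∫ x in (a n)..(M - a n), q x ≤ K := fun n =>
    hK _ ⟨(hapos n).trans (hlt n), by linarith [hapos n]⟩ _ ⟨hapos n, hlt n⟩
  have hI : IntegrableOn q (Ioc 0 M) := by
    refine integrableOn_Ioc_of_intervalIntegral_norm_bounded (I := K) (l := atTop)
      (a := a) (b := fun n => M - a n) ?_ hat hbt ?_
    · intro n
      exact ((hqc.mono (hsub n)).integrableOn_Icc).mono_set Ioc_subset_Icc_self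
    · filter_upwards with n
      rw [← intervalIntegral.integral_of_le (hlt n).le]
      refine le_trans (le_of_eq ?_) (hb n)
      apply intervalIntegral.integral_congr
      intro x hx
      rw [uIcc_of_le (hlt n).le] at hx
      simp only [Real.norm_eq_abs]
      exact abs_of_nonneg (hq0 x (hsub n hx))
  refine ⟨hI, ?_⟩
  have hii : IntervalIntegrable q volume 0 M :=
    (intervalIntegrable_iff_integrableOn_Ioc_of_le hM.le).2 hI
  have hc : ContinuousOn (fun x => ∫ r in (0:ℝ)..x, q r) (uIcc 0 M) :=
    intervalIntegral.continuousOn_primitive_interval' hii left_mem_uIcc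
  rw [uIcc_of_le hM.le] at hc
  have t1 : Tendsto (fun n => ∫ r in (0:ℝ)..(a n), q r) atTop (nhds (∫ r in (0:ℝ)..0, q r)) := by
    refine (hc 0 ⟨le_rfl, hM.le⟩).tendsto.comp (tendsto_nhdsWithin_iff.2 ⟨hat, ?_⟩)
    filter_upwards with n
    exact ⟨(hapos n).le, by linarith [hale n]⟩
  have t2 : Tendsto (fun n => ∫ r in (0:ℝ)..(M - a n), q r) atTop
      (nhds (∫ r in (0:ℝ)..M, q r)) := by
    refine (hc M ⟨hM.le, le_rfl⟩).tendsto.comp (tendsto_nhdsWithin_iff.2 ⟨hbt, ?_⟩)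
    filter_upwards with n
    exact ⟨by linarith [hale n], by linarith [hapos n]⟩
  have t3 := t2.sub t1
  rw [intervalIntegral.integral_same, sub_zero] at t3
  refine le_of_tendsto t3 ?_
  filter_upwards with n
  refine le_trans (le_of_eq ?_) (hb n)
  rw [intervalIntegral.integral_interval_sub_left]
  · exact hii.mono_set (by
      rw [uIcc_of_le hM.le, uIcc_of_le (by linarith [hale n])]
      exact Icc_subset_Icc le_rfl (by linarith [hapos n]))
  · exact hii.mono_set (by
      rw [uIcc_of_le hM.le, uIcc_of_le (by linarith [hapos n])]
      exact Icc_subset_Icc le_rfl (by linarith [hale n]))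

lemma flow {M : ℝ} (hM : 0 < M) {p w q : ℝ → ℝ} (hw : Continuous w) (hw0 : w 0 = M)
    (hwp : ∀ t, 0 < w t) (hwM : ∀ t > 0, w t < M)
    (hd : ∀ t > 0, HasDerivAt w (- p (w t)) t) (hlim : Tendsto w atTop (nhds 0))
    (hp : ∀ x ∈ Ioo 0 M, 0 ≤ p x)
    (hqc : ContinuousOn q (Ioo 0 M)) (hq0 : ∀ x ∈ Ioo 0 M, 0 ≤ q x)
    (hqi : IntegrableOn q (Ioc 0 M)) :
    IntegrableOn (fun t => q (w t) * p (w t)) (Ioi 0) ∧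
      ∫ t in Ioi (0:ℝ), q (w t) * p (w t) = ∫ x in (0:ℝ)..M, q x := by
  have hii : IntervalIntegrable q volume 0 M :=
    (intervalIntegrable_iff_integrableOn_Ioc_of_le hM.le).2 hqi
  have hc : ContinuousOn (fun x => ∫ r in (0:ℝ)..x, q r) (uIcc 0 M) :=
    intervalIntegral.continuousOn_primitive_interval' hii left_mem_uIcc
  rw [uIcc_of_le hM.le] at hc
  set Q : ℝ → ℝ := fun x => ∫ r in (0:ℝ)..x, q r with hQ
  have hmem : ∀ t, 0 ≤ t → w t ∈ Icc 0 M := by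
    intro t ht
    rcases eq_or_lt_of_le ht with h | h
    · rw [← h, hw0]; exact ⟨hM.le, le_rfl⟩
    · exact ⟨(hwp t).le, (hwM t h).le⟩
  have hder : ∀ t ∈ Ioi (0:ℝ), HasDerivAt (fun t => Q (w t)) (-(q (w t) * p (w t))) t := by
    intro t ht
    have hx : w t ∈ Ioo 0 M := ⟨hwp t, hwM t ht⟩
    have hQd : HasDerivAt Q (q (w t)) (w t) := by
      apply intervalIntegral.integral_hasDerivAt_right
      · exact hii.mono_set (by
          rw [uIcc_of_le hM.le, uIcc_of_le hx.1.le]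
          exact Icc_subset_Icc le_rfl hx.2.le)
      · exact hqc.stronglyMeasurableAtFilter isOpen_Ioo _ hx
      · exact hqc.continuousAt (isOpen_Ioo.mem_nhds hx)
    have := hQd.comp t (hd t ht)
    exact this.congr_deriv (by ring)
  have hneg : ∀ t ∈ Ioi (0:ℝ), -(q (w t) * p (w t)) ≤ 0 := by
    intro t ht
    have hx : w t ∈ Ioo 0 M := ⟨hwp t, hwM t ht⟩
    have := mul_nonneg (hq0 _ hx) (hp _ hx)
    linarith
  have hcw : ContinuousWithinAt (fun t => Q (w t)) (Ici 0) 0 := by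
    have h1 : ContinuousOn (fun t => Q (w t)) (Ici 0) :=
      hc.comp hw.continuousOn (fun t ht => hmem t ht)
    exact h1 0 self_mem_Ici
  have ht : Tendsto (fun t => Q (w t)) atTop (nhds 0) := by
    have h0 : Q 0 = 0 := by simp [hQ]
    rw [← h0]
    refine (hc 0 ⟨le_rfl, hM.le⟩).tendsto.comp (tendsto_nhdsWithin_iff.2 ⟨hlim, ?_⟩)
    filter_upwards [eventually_ge_atTop 0] with t ht using hmem t ht
  have h1 := integrableOn_Ioi_deriv_of_nonpos hcw hder hneg ht
  have h2 := integral_Ioi_of_hasDerivAt_of_nonpos hcw hder hneg ht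
  refine ⟨by simpa using h1.neg, ?_⟩
  rw [integral_neg, hw0] at h2
  linarith

lemma plateau {M L : ℝ} (hL : 0 ≤ L) {g w : ℝ → ℝ} (hw0 : ∀ t ≤ 0, w t = M)
    (hg : IntegrableOn (fun t => g (w t)) (Ioi 0)) :
    Integrable (fun t => g (w (|t| - L))) ∧
      ∫ t, g (w (|t| - L)) = 2 * (L * g M + ∫ t in Ioi (0:ℝ), g (w t)) := by
  have hdisj : Disjoint (Ioc 0 L) (Ioi L) := by
    rw [Set.disjoint_left]; intro x hx hx2; exact absurd hx.2 (not_le.2 hx2)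
  have hun : Ioc 0 L ∪ Ioi L = Ioi (0:ℝ) := Ioc_union_Ioi_eq_Ioi hL
  have hc : ∀ t ∈ Ioc 0 L, g M = g (w (t - L)) := fun t ht => by
    rw [hw0 (t - L) (by linarith [ht.2])]
  have i1 : IntegrableOn (fun t => g (w (t - L))) (Ioc 0 L) := by
    refine IntegrableOn.congr_fun (f := fun _ => g M) ?_ hc measurableSet_Ioc
    exact integrableOn_const (by simp)
  have hpre : (fun t : ℝ => t - L) ⁻¹' Ioi 0 = Ioi L := by
    ext x; simp
  have i2 : IntegrableOn (fun t => g (w (t - L))) (Ioi L) := by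
    have := (measurePreserving_sub_right volume L).integrableOn_comp_preimage
      (Homeomorph.subRight L).measurableEmbedding (f := fun t => g (w t)) (s := Ioi 0)
    rw [hpre] at this
    exact this.2 hg
  have e1 : ∫ t in Ioc 0 L, g (w (t - L)) = L * g M := by
    rw [← setIntegral_congr_fun measurableSet_Ioc hc]
    simp [hL]
  have e2 : ∫ t in Ioi L, g (w (t - L)) = ∫ t in Ioi (0:ℝ), g (w t) := by
    have := (measurePreserving_sub_right volume L).setIntegral_preimage_emb
      (Homeomorph.subRight L).measurableEmbedding (fun t => g (w t)) (Ioi 0)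
    rw [hpre] at this
    exact this
  have i3 : IntegrableOn (fun t => g (w (t - L))) (Ioi 0) := by
    rw [← hun]; exact i1.union i2
  have i4 : IntegrableOn (fun t => g (w (|t| - L))) (Ioi 0) := by
    refine i3.congr_fun ?_ measurableSet_Ioi
    intro t ht
    simp only
    rw [abs_of_pos ht]
  have i5 : IntegrableOn (fun t => g (w (|t| - L))) (Iic 0) := by
    rw [← Measure.map_neg_eq_self (volume : Measure ℝ)]
    let m : MeasurableEmbedding fun x : ℝ => -x := (Homeomorph.neg ℝ).measurableEmbedding
    rw [m.integrableOn_map_iff]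
    simp_rw [Function.comp_def, abs_neg, neg_preimage, neg_Iic, neg_zero]
    exact Iff.mpr integrableOn_Ici_iff_integrableOn_Ioi i4
  constructor
  · rw [← integrableOn_univ, ← Iic_union_Ioi (a := (0:ℝ))]
    exact i5.union i4
  · rw [← e2, ← e1, ← setIntegral_union hdisj measurableSet_Ioi i1 i2, hun]
    exact integral_comp_abs (f := fun t => g (w (t - L)))

lemma beta_AC {M L : ℝ} (hL : 0 ≤ L) {p w : ℝ → ℝ} (hw : Continuous w)
    (hw0 : ∀ t ≤ 0, w t = M) (hwb : ∀ t, w t ∈ Icc 0 M) (hpc : ContinuousOn p (Icc 0 M))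
    (hpM : p M = 0) (hd : ∀ t > 0, HasDerivAt w (- p (w t)) t) :
    LocAC (fun t => 1 - w (|t| - L))
      (fun t => (if 0 ≤ t then 1 else -1) * p (w (|t| - L))) := by
  have hWc : Continuous (fun t => w (|t| - L)) := hw.comp (continuous_abs.sub continuous_const)
  have hpw : Continuous (fun t => p (w (|t| - L))) :=
    hpc.comp_continuous hWc (fun t => hwb _)
  have hmeas : Measurable (fun t : ℝ => if 0 ≤ t then (1:ℝ) else -1) :=
    Measurable.ite measurableSet_Ici measurable_const measurable_const
  have hI : ∀ a b : ℝ, IntegrableOn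
      (fun t => (if 0 ≤ t then (1:ℝ) else -1) * p (w (|t| - L))) (Icc a b) := by
    intro a b
    refine Integrable.bdd_mul (c := 1) (hpw.continuousOn.integrableOn_Icc) hmeas.aestronglyMeasurable ?_
    filter_upwards with t
    split_ifs <;> simp
  refine ⟨hI, ?_⟩
  intro a t
  have hFTC := integral_eq_of_hasDerivAt_off_countable (a := a) (b := t)
    (fun t => 1 - w (|t| - L)) (fun t => (if 0 ≤ t then (1:ℝ) else -1) * p (w (|t| - L)))
    (s := {0, L, -L}) (Set.Finite.countable (by simp)) (continuous_const.sub hWc).continuousOn ?_ ?_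
  · rw [hFTC]; ring
  · rintro x ⟨-, hx⟩
    simp only [mem_insert_iff, mem_singleton_iff, not_or] at hx
    obtain ⟨hx0, hxL, hxL'⟩ := hx
    rcases lt_trichotomy |x| L with h | h | h
    · have hev : (fun t => 1 - w (|t| - L)) =ᶠ[nhds x] fun _ => 1 - M := by
        have : ∀ᶠ y in nhds x, |y| < L := continuous_abs.continuousAt.eventually_lt continuousAt_const h
        filter_upwards [this] with y hy
        rw [hw0 _ (by linarith)]
      have h2 : w (|x| - L) = M := hw0 _ (by linarith)
      rw [h2, hpM, mul_zero]
      exact (hasDerivAt_const x (1 - M)).congr_of_eventuallyEq hev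
    · rcases abs_choice x with h3 | h3
      · exact absurd (h3.symm.trans h) hxL
      · exact absurd (by linarith) hxL'
    · have h1 := hd (|x| - L) (by linarith)
      rcases lt_or_gt_of_ne hx0 with hn | hp
      · have h2 : HasDerivAt (fun t : ℝ => |t| - L) (-1) x := (hasDerivAt_abs_neg hn).sub_const L
        have h3 := ((h1.comp x h2).const_sub 1)
        rw [if_neg (not_le.2 hn)]
        exact h3.congr_deriv (by ring)
      · have h2 : HasDerivAt (fun t : ℝ => |t| - L) 1 x := (hasDerivAt_abs_pos hp).sub_const L
        have h3 := ((h1.comp x h2).const_sub 1)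
        rw [if_pos hp.le]
        exact h3.congr_deriv (by ring)
  · exact (hI _ _).intervalIntegrable

lemma FHyp.construct (hf : FHyp ℓ ℓ₁ f f₁) {s M : ℝ} (hs : 0 < s) (hM : M ∈ Ioo (0:ℝ) 1)
    (hmin : ∀ M' ∈ Ioo (0:ℝ) 1, Phi f₁ s M ≤ Phi f₁ s M') :
    ∃ α α' β β' : ℝ → ℝ, MemU1 α α' β β' ∧
      Gfun f s α' β β' = ENNReal.ofReal (Phi f₁ s M) := by
  obtain ⟨hM0, hM1⟩ := hM
  have hfM := hf.pos hM0.le hM1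
  set p := pp f₁ M with hp
  have hpM : p M = 0 := hf.pp_zero_of_le hM0.le le_rfl hM1
  have hpc : ContinuousOn p (Icc 0 M) :=
    (hf.pp_contOn M).mono fun x hx => ⟨hx.1, hx.2.trans_lt hM1⟩
  have hppos : ∀ x ∈ Ioo 0 M, 0 < p x := fun x hx => hf.pp_pos hx.1 hx.2 hM1.le
  have hple : ∀ x ∈ Icc 0 M, p x ≤ x := fun x hx => by
    have := pp_le (f₁ := f₁) (M := M) hx.1
    have h0 := hx.1
    simp only [hp]
    linarith
  set h : ℝ → ℝ := fun x => (x / f₁ x) ^ 2 with hh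
  have hfc : ContinuousOn f₁ (Icc 0 M) := hf.cont.mono (Icc_subset_Icc le_rfl hM1.le)
  have hfpos : ∀ x ∈ Icc 0 M, 0 < f₁ x := fun x hx => hf.pos hx.1 (hx.2.trans_lt hM1)
  have hhc : ContinuousOn h (Icc 0 M) :=
    (continuousOn_id.div hfc fun x hx => (hfpos x hx).ne').pow 2
  have hhM : 0 < h M := by simp only [hh]; positivity
  set q : ℝ → ℝ := fun x => h x / p x with hq
  have hqc : ContinuousOn q (Ioo 0 M) :=
    (hhc.mono Ioo_subset_Icc_self).div (hpc.mono Ioo_subset_Icc_self)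
      fun x hx => (hppos x hx).ne'
  have hq0 : ∀ x ∈ Ioo 0 M, 0 ≤ q x := fun x hx =>
    div_nonneg (sq_nonneg _) (hppos x hx).le
  obtain ⟨hqi, hqK⟩ := bdd_integrable hM0 hqc hq0
    (K := s / f₁ M) (fun b hb a ha => hf.Kbound ⟨hM0, hM1⟩ hmin hb ha)
  have hInt : ∀ c ∈ Ioo 0 M, IntegrableOn (fun x => 1 / p x) (Icc c M) := by
    intro c hc
    have h1 : IntegrableOn q (Icc c M) :=
      hqi.mono_set fun x hx => ⟨hc.1.trans_le hx.1, hx.2⟩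
    have h2 : ContinuousOn (fun x => (f₁ x / x) ^ 2) (Icc c M) :=
      ((hfc.mono (Icc_subset_Icc hc.1.le le_rfl)).div continuousOn_id
        fun x hx => (hc.1.trans_le hx.1).ne').pow 2
    refine (h1.mul_continuousOn h2 isCompact_Icc).congr_fun ?_ measurableSet_Icc
    intro x hx
    have hx0 : 0 < x := hc.1.trans_le hx.1
    have hf0 := hfpos x ⟨hx0.le, hx.2⟩
    simp only [hq, hh]
    field_simp
  obtain ⟨w, hwc, hw0, hwb, hwlt, hwd, hwl⟩ := profile hM0 hM1 hpc hppos hple hInt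
  have hwI : ∀ t, w t ∈ Icc 0 M := fun t => ⟨(hwb t).1.le, (hwb t).2⟩
  obtain ⟨fa, fb⟩ := flow hM0 hwc (hw0 0 le_rfl) (fun t => (hwb t).1) hwlt hwd hwl
    (fun x hx => (hppos x hx).le) hqc hq0 hqi
  have hpi : IntegrableOn p (Ioc 0 M) := hpc.integrableOn_Icc.mono_set Ioc_subset_Icc_self
  obtain ⟨fc, fd⟩ := flow hM0 hwc (hw0 0 le_rfl) (fun t => (hwb t).1) hwlt hwd hwl
    (fun x hx => (hppos x hx).le) (hpc.mono Ioo_subset_Icc_self)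
    (fun x hx => (hppos x hx).le) hpi
  have hqh : EqOn (fun t => q (w t) * p (w t)) (fun t => h (w t)) (Ioi 0) := by
    intro t ht
    have := hppos (w t) ⟨(hwb t).1, hwlt t ht⟩
    simp only [hq]
    field_simp
  rw [setIntegral_congr_fun measurableSet_Ioi hqh] at fb
  replace fa := fa.congr_fun hqh measurableSet_Ioi
  set K := ∫ x in (0:ℝ)..M, q x with hK
  set L := (s / f₁ M - K) / h M with hLd
  have hL : 0 ≤ L := div_nonneg (by linarith) hhM.le
  obtain ⟨pa, pb⟩ := plateau (M := M) (g := h) hL hw0 fa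
  obtain ⟨pc, pd⟩ := plateau (M := M) (g := fun x => p x * p x) hL hw0 fc
  rw [fb] at pb
  rw [fd] at pd
  have pb2 : ∫ t, h (w (|t| - L)) = 2 * (s / f₁ M) := by
    rw [pb]; congr 1; rw [hLd]; field_simp; ring
  set P := ∫ x in (0:ℝ)..M, p x with hP
  have pd2 : ∫ t, p (w (|t| - L)) * p (w (|t| - L)) = 2 * P := by
    rw [pd]; simp [hpM]
  have hPhi : Phi f₁ s M = s * f₁ M + 4 * P := by
    unfold Phi
    rw [hf.integral_pp hM0.le le_rfl hM1]
  have hAi : Integrable (fun t => f₁ M / (2 * s) * h (w (|t| - L))) := pa.const_mul _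
  refine ⟨fun t => ∫ x in (0:ℝ)..t, f₁ M / (2 * s) * h (w (|x| - L)),
    fun t => f₁ M / (2 * s) * h (w (|t| - L)), fun t => 1 - w (|t| - L),
    fun t => (if 0 ≤ t then 1 else -1) * p (w (|t| - L)),
    ⟨⟨fun a b => hAi.integrableOn, ?_⟩, beta_AC hL hwc hw0 hwI hpc hpM hwd, hAi, ?_, ?_, ?_, ?_⟩, ?_⟩
  · intro a t
    exact (intervalIntegral.integral_add_adjacent_intervals hAi.intervalIntegrable
      hAi.intervalIntegrable).symm
  · rw [integral_const_mul, pb2]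
    have : f₁ M / (2 * s) * (2 * (s / f₁ M)) = 1 := by field_simp
    rw [this, abs_one]
  · intro t
    have := hwI (|t| - L)
    exact ⟨by linarith [this.2], by linarith [this.1]⟩
  · have : Tendsto (fun t : ℝ => |t| - L) atTop atTop :=
      tendsto_atTop_add_const_right _ _ tendsto_abs_atTop_atTop
    simpa using (tendsto_const_nhds (x := (1:ℝ))).sub (hwl.comp this)
  · have : Tendsto (fun t : ℝ => |t| - L) atBot atTop :=
      tendsto_atTop_add_const_right _ _ tendsto_abs_atBot_atTop
    simpa using (tendsto_const_nhds (x := (1:ℝ))).sub (hwl.comp this)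
  · unfold Gfun
    have hpt : ∀ t : ℝ, (ENNReal.ofReal (s ^ 2 * (f₁ M / (2 * s) * h (w (|t| - L))) ^ 2)
        * (f (1 - w (|t| - L))) ^ 2
        + ENNReal.ofReal ((1 - (1 - w (|t| - L))) ^ 2 / 4
          + ((if 0 ≤ t then 1 else -1) * p (w (|t| - L))) ^ 2))
        = ENNReal.ofReal ((f₁ M) ^ 2 / 2 * h (w (|t| - L))
          + 2 * (p (w (|t| - L)) * p (w (|t| - L)))) := by
      intro t
      generalize hx : w (|t| - L) = x
      have hx0 : 0 < x := hx ▸ (hwb _).1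
      have hxM : x ≤ M := hx ▸ (hwb _).2
      have hfx := hfpos x ⟨hx0.le, hxM⟩
      have hsq := hf.pp_sq hx0.le hxM hM1
      have hsg : ((if 0 ≤ t then (1:ℝ) else -1) * p x) ^ 2 = p x ^ 2 := by
        split_ifs <;> ring
      rw [hsg, hf.f_eq hx0 (hxM.trans hM1.le), ← ENNReal.ofReal_pow (by positivity),
        ← ENNReal.ofReal_mul (by positivity), ← ENNReal.ofReal_add (by positivity) (by positivity)]
      congr 1
      have e1 : s ^ 2 * (f₁ M / (2 * s) * h x) ^ 2 * (f₁ x / x) ^ 2 = (f₁ M / 2) ^ 2 * h x := by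
        simp only [hh]; field_simp
      rw [e1]
      have e2 : p x ^ 2 = x ^ 2 / 4 - (f₁ M / 2) ^ 2 * h x := hsq
      linear_combination (-1) * e2
    rw [lintegral_congr hpt, ← ofReal_integral_eq_lintegral_ofReal]
    · rw [integral_add (pa.const_mul _) (pc.const_mul _), integral_const_mul, integral_const_mul,
        pb2, pd2, hPhi]
      congr 1
      field_simp
      ring
    · exact (pa.const_mul _).add (pc.const_mul _)
    · filter_upwards with t
      have h1 : 0 ≤ h (w (|t| - L)) := sq_nonneg _
      have h2 := mul_self_nonneg (p (w (|t| - L)))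
      simp only [Pi.zero_apply]
      positivity

lemma zero_case (f : ℝ → ℝ≥0∞) :
    ∃ α α' β β' : ℝ → ℝ, MemU1 α α' β β' ∧ Gfun f 0 α' β β' = 0 := by
  have hI : Integrable (indicator (Icc (0:ℝ) 1) (fun _ => (1:ℝ))) :=
    (integrable_indicator_iff measurableSet_Icc).2 (integrableOn_const (by simp))
  refine ⟨fun t => ∫ x in (0:ℝ)..t, indicator (Icc (0:ℝ) 1) (fun _ => (1:ℝ)) x,
    indicator (Icc (0:ℝ) 1) (fun _ => (1:ℝ)), fun _ => 1, fun _ => 0,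
    ⟨⟨fun a b => hI.integrableOn, ?_⟩, ⟨fun a b => by simp, by simp⟩, hI, ?_, by simp, by simp, by simp⟩, ?_⟩
  · intro a t
    exact (intervalIntegral.integral_add_adjacent_intervals hI.intervalIntegrable
      hI.intervalIntegrable).symm
  · rw [integral_indicator measurableSet_Icc]; simp
  · simp [Gfun]

/-- if `g₀(s) < 1` then the infimum defining `g₀(s)` is attained, and every
minimizer `(α, β) ∈ 𝒰₁` satisfies `β ≥ 1 − √(g₀(s))` everywhere. -/
theorem stmt_14 (ℓ ℓ₁ : ℝ) (f : ℝ → ℝ≥0∞) (f₁ : ℝ → ℝ) (hf : FHyp ℓ ℓ₁ f f₁)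
    (s : ℝ) (hs : 0 ≤ s) (hlt : g0E f s < 1) :
    (∃ α α' β β' : ℝ → ℝ, MemU1 α α' β β' ∧ Gfun f s α' β β' = g0E f s) ∧
    (∀ α α' β β' : ℝ → ℝ, MemU1 α α' β β' → Gfun f s α' β β' = g0E f s →
      ∀ t : ℝ, 1 - Real.sqrt ((g0E f s).toReal) ≤ β t) := by
  refine ⟨?_, fun α α' β β' h hG t => part2 hlt h hG t⟩
  rcases eq_or_lt_of_le hs with h0 | hs
  · subst h0
    obtain ⟨α, α', β, β', h, hG⟩ := zero_case f
    refine ⟨α, α', β, β', h, ?_⟩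
    have : g0E f 0 ≤ 0 := sInf_le ⟨α, α', β, β', h, hG.symm⟩
    rw [hG, le_antisymm this zero_le]
  · obtain ⟨x, ⟨α, α', β, β', h, rfl⟩, hx⟩ := sInf_lt_iff.1 hlt
    obtain ⟨M1, hM1, hle⟩ := hf.lower hs h hx
    have hP1 : Phi f₁ s M1 < 1 := by
      have := hle.trans_lt hx
      rwa [ENNReal.ofReal_lt_one] at this
    obtain ⟨M, hM, hmin⟩ := hf.exists_min hs ⟨M1, hM1, hP1⟩
    obtain ⟨a, a', b, b', hU, hG⟩ := hf.construct hs hM hmin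
    refine ⟨a, a', b, b', hU, le_antisymm ?_ (sInf_le ⟨a, a', b, b', hU, rfl⟩)⟩
    rw [hG]
    refine le_sInf ?_
    rintro y ⟨c, c', d, d', hV, rfl⟩
    rcases lt_or_ge (Gfun f s c' d d') 1 with hy | hy
    · obtain ⟨M2, hM2, hle2⟩ := hf.lower hs hV hy
      exact (ENNReal.ofReal_le_ofReal (hmin M2 hM2)).trans hle2
    · exact ((ENNReal.ofReal_le_ofReal (hmin M1 hM1)).trans (hle.trans hx.le)).trans hy
end
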